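/- arXiv:2401.02006 — 9 statements merged into one kernel-verified Lean document; each statement's English description precedes it below -/
import Mathlib

section
/- Let A be a commutative noetherian ring, M an A-module, and z a nonzero element of A. Assume that Tor_1^A(M, A/zA) = 0 and that M/zM is a flat (A/zA)-module. Then Tor_i^A(M, N) = 0 for every A-module N annihilated by z and every i ≥ 1. -/
/-!
Lemma 4.4: let `A` be a commutative noetherian ring, `M` an `A`-module and `z ∈ A` a nonzero
element.  If `Tor₁^A(M, A/zA) = 0` and `M/zM` is a flat `A/zA`-module, then
`Tor_i^A(M, N) = 0` for every `A`-module `N` annihilated by `z` and every `i ≥ 1`.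
-/

set_option synthInstance.maxHeartbeats 1000000

open CategoryTheory

universe u

namespace CharacterModule

variable {A B C : Type*} [AddCommGroup A] [AddCommGroup B] [AddCommGroup C]
variable {R : Type*} [CommRing R] [Module R A] [Module R B] [Module R C]

theorem dual_exact_iff {f : A →ₗ[R] B} {g : B →ₗ[R] C} :
    Function.Exact (dual g) (dual f) ↔ Function.Exact f g := by
  constructor
  · intro h x
    constructor
    · intro hx
      by_contra hxf
      obtain ⟨c, hc⟩ := exists_character_apply_ne_zero_of_ne_zero
        (a := (LinearMap.range f).mkQ x) (by simpa using hxf)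
      obtain ⟨d, hd⟩ := (h (dual (LinearMap.range f).mkQ c)).1 (by
        ext a
        change c ((LinearMap.range f).mkQ (f a)) = 0
        rw [Submodule.mkQ_apply,
          (Submodule.Quotient.mk_eq_zero _).2 (LinearMap.mem_range_self f a)]
        exact map_zero c)
      apply hc
      change dual (LinearMap.range f).mkQ c x = 0
      rw [← hd]
      change d (g x) = 0
      rw [hx]
      exact map_zero d
    · rintro ⟨a, rfl⟩
      exact eq_zero_of_character_apply fun c ↦
        DFunLike.congr_fun ((h (dual g c)).2 ⟨c, rfl⟩) a
  · intro h c
    constructor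
    · intro hc
      obtain ⟨d, hd⟩ := dual_surjective_of_injective
        ((LinearMap.range f).liftQ g (LinearMap.range_le_ker_iff.2 h.linearMap_comp_eq_zero))
        (LinearMap.ker_eq_bot.1 <| by
          rw [Submodule.ker_liftQ, h.linearMap_ker_eq, Submodule.mkQ_map_self])
        (QuotientAddGroup.lift (LinearMap.range f).toAddSubgroup c (by
          rintro _ ⟨a, rfl⟩
          exact DFunLike.congr_fun hc a))
      exact ⟨d, by ext b; exact DFunLike.congr_fun hd ((LinearMap.range f).mkQ b)⟩
    · rintro ⟨d, rfl⟩
      ext a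
      change d (g (f a)) = 0
      rw [h.apply_apply_eq_zero]
      exact map_zero d

theorem _root_.lTensor_exact_iff_lcomp_exact {M : Type*} [AddCommGroup M] [Module R M]
    {f : A →ₗ[R] B} {g : B →ₗ[R] C} :
    Function.Exact (f.lTensor M) (g.lTensor M) ↔
      Function.Exact (g.lcomp R (CharacterModule M)) (f.lcomp R (CharacterModule M)) := by
  have h : Function.Exact (f.lTensor M) (g.lTensor M) ↔
      Function.Exact (f.rTensor M) (g.rTensor M) :=
    (Function.Exact.iff_of_ladder_linearEquiv (e₁ := TensorProduct.comm R M A)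
      (e₂ := TensorProduct.comm R M B) (e₃ := TensorProduct.comm R M C)
      (by ext; rfl) (by ext; rfl)).symm
  rw [h, ← dual_exact_iff]
  exact (Function.Exact.iff_of_ladder_linearEquiv (e₁ := homEquiv.symm) (e₂ := homEquiv.symm)
    (e₃ := homEquiv.symm) rfl rfl).symm

end CharacterModule

theorem IsNoetherianRing.exists_forall_pow_succ_mul_eq_zero {R : Type*} [CommRing R]
    [IsNoetherianRing R] (z : R) :
    ∃ n : ℕ, ∀ a : R, z ^ (n + 1) * a = 0 → z ^ n * a = 0 := by
  obtain ⟨n, hn⟩ := monotone_stabilizes_iff_noetherian.2 ‹IsNoetherianRing R›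
    (LinearMap.iterateKer (LinearMap.lsmul R R z))
  have h (k : ℕ) (a : R) :
      a ∈ LinearMap.iterateKer (LinearMap.lsmul R R z) k ↔ z ^ k * a = 0 := by
    change ((LinearMap.lsmul R R z) ^ k) a = 0 ↔ _
    rw [show LinearMap.lsmul R R z = Module.toModuleEnd R (S := R) R z from rfl, ← map_pow]
    rfl
  exact ⟨n, fun a ha ↦ (h n a).1 (hn (n + 1) n.le_succ ▸ (h (n + 1) a).2 ha)⟩

namespace ModuleCat

variable {A : Type u} [CommRing A]

theorem subsingleton_Tor_succ_iff_subsingleton_Ext (M N : Type u) [AddCommGroup M] [Module A M]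
    [AddCommGroup N] [Module A N] (n : ℕ) :
    Subsingleton (((Tor (ModuleCat.{u} A) (n + 1)).obj (of A M)).obj (of A N)) ↔
      Subsingleton (Abelian.Ext (of A N) (of A (CharacterModule M)) (n + 1)) := by
  let P : ProjectiveResolution (of A N) := CategoryTheory.projectiveResolution _
  let F := (MonoidalCategory.tensoringLeft (ModuleCat.{u} A)).obj (of A M)
  have h₁ : Subsingleton (((Tor (ModuleCat.{u} A) (n + 1)).obj (of A M)).obj (of A N)) ↔
      Function.Exact ((P.complex.d (n + 2) (n + 1)).hom.lTensor M)
        ((P.complex.d (n + 1) n).hom.lTensor M) := by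
    rw [← isZero_iff_subsingleton]
    refine (P.isoLeftDerivedObj F (n + 1)).isZero_iff.trans ?_
    refine (HomologicalComplex.exactAt_iff_isZero_homology _ _).symm.trans ?_
    rw [HomologicalComplex.exactAt_iff' _ (n + 2) (n + 1) n (by simp) (by simp),
      ShortComplex.ShortExact.moduleCat_exact_iff_function_exact]
    rfl
  rw [h₁, lTensor_exact_iff_lcomp_exact]
  constructor
  · intro h
    refine subsingleton_of_forall_eq 0 fun x ↦ ?_
    obtain ⟨f, hf, rfl⟩ := P.extMk_surjective x (n + 2) rfl
    rw [P.extMk_eq_zero_iff f _ rfl hf n rfl]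
    obtain ⟨g, hg⟩ := (h f.hom).1 (congr_arg Hom.hom hf)
    exact ⟨ofHom g, hom_ext hg⟩
  · intro h f
    constructor
    · intro hf
      obtain ⟨g, hg⟩ := (P.extMk_eq_zero_iff (ofHom f) _ rfl (hom_ext hf) n rfl).1
        (Subsingleton.elim _ _)
      exact ⟨g.hom, congr_arg Hom.hom hg⟩
    · rintro ⟨g, rfl⟩
      have := congr_arg Hom.hom (P.complex.d_comp_d (n + 2) (n + 1) n)
      ext1 x
      exact (congr_arg g (LinearMap.congr_fun this x)).trans (map_zero g)

variable (E : ModuleCat.{u} A)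

section LongExactSequence

variable {X Y Z : Type u} [AddCommGroup X] [Module A X] [AddCommGroup Y] [Module A Y]
  [AddCommGroup Z] [Module A Z] {f : X →ₗ[A] Y} {g : Y →ₗ[A] Z}

theorem shortExact_of_function_exact (hf : Function.Injective f) (hg : Function.Surjective g)
    (h : Function.Exact f g) :
    (ShortComplex.mk (ofHom f) (ofHom g) (hom_ext h.linearMap_comp_eq_zero)).ShortExact :=
  shortComplex_shortExact _ h hf hg

theorem subsingleton_Ext_of_exact_middle (hf : Function.Injective f)
    (hg : Function.Surjective g) (h : Function.Exact f g) {i : ℕ}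
    [Subsingleton (Abelian.Ext (of A X) E i)] [Subsingleton (Abelian.Ext (of A Z) E i)] :
    Subsingleton (Abelian.Ext (of A Y) E i) := by
  refine subsingleton_of_forall_eq 0 fun x ↦ ?_
  obtain ⟨y, rfl⟩ := Abelian.Ext.contravariant_sequence_exact₂
    (shortExact_of_function_exact hf hg h) E x
    (Subsingleton.elim (α := Abelian.Ext (of A X) E i) _ _)
  rw [Subsingleton.elim (α := Abelian.Ext (of A Z) E i) y 0, Abelian.Ext.comp_zero]

theorem subsingleton_Ext_succ_of_exact (hf : Function.Injective f)
    (hg : Function.Surjective g) (h : Function.Exact f g) {i : ℕ}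
    [Subsingleton (Abelian.Ext (of A X) E i)] [Subsingleton (Abelian.Ext (of A Y) E (i + 1))] :
    Subsingleton (Abelian.Ext (of A Z) E (i + 1)) := by
  refine subsingleton_of_forall_eq 0 fun x ↦ ?_
  obtain ⟨y, rfl⟩ := Abelian.Ext.contravariant_sequence_exact₃
    (shortExact_of_function_exact hf hg h) E x
    (Subsingleton.elim (α := Abelian.Ext (of A Y) E (i + 1)) _ _) (add_comm 1 i)
  rw [Subsingleton.elim (α := Abelian.Ext (of A X) E i) y 0, Abelian.Ext.comp_zero]

theorem subsingleton_Ext_succ_of_ker (hg : Function.Surjective g) {i : ℕ}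
    [Subsingleton (Abelian.Ext (of A (LinearMap.ker g)) E i)]
    [Subsingleton (Abelian.Ext (of A Y) E (i + 1))] :
    Subsingleton (Abelian.Ext (of A Z) E (i + 1)) :=
  subsingleton_Ext_succ_of_exact E (LinearMap.ker g).injective_subtype hg
    (LinearMap.exact_subtype_ker_map g)

variable {E} in
theorem exists_comp_eq_of_subsingleton_Ext_one (hf : Function.Injective f)
    (hg : Function.Surjective g) (h : Function.Exact f g)
    [Subsingleton (Abelian.Ext (of A Z) E 1)] (φ : X →ₗ[A] E) :
    ∃ ψ : Y →ₗ[A] E, ψ ∘ₗ f = φ := by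
  obtain ⟨y, hy⟩ := Abelian.Ext.contravariant_sequence_exact₁
    (shortExact_of_function_exact hf hg h) E (Abelian.Ext.mk₀ (ofHom φ)) (add_zero 1)
    (Subsingleton.elim (α := Abelian.Ext (of A Z) E 1) _ _)
  obtain ⟨ψ, rfl⟩ := (Abelian.Ext.mk₀_bijective _ _).2 y
  rw [Abelian.Ext.mk₀_comp_mk₀] at hy
  exact ⟨ψ.hom, congr_arg Hom.hom ((Abelian.Ext.mk₀_bijective _ _).1 hy)⟩

theorem subsingleton_Ext_one_of_forall_exists_comp_eq (hf : Function.Injective f)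
    (hg : Function.Surjective g) (h : Function.Exact f g)
    [Subsingleton (Abelian.Ext (of A Y) E 1)]
    (H : ∀ φ : X →ₗ[A] E, ∃ ψ : Y →ₗ[A] E, ψ ∘ₗ f = φ) :
    Subsingleton (Abelian.Ext (of A Z) E 1) := by
  refine subsingleton_of_forall_eq 0 fun x ↦ ?_
  obtain ⟨y, rfl⟩ := Abelian.Ext.contravariant_sequence_exact₃
    (shortExact_of_function_exact hf hg h) E x
    (Subsingleton.elim (α := Abelian.Ext (of A Y) E 1) _ _) (add_zero 1)
  obtain ⟨φ, rfl⟩ := (Abelian.Ext.mk₀_bijective _ _).2 y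
  obtain ⟨ψ, hψ⟩ := H φ.hom
  rw [show φ = ofHom f ≫ ofHom ψ from hom_ext hψ.symm, ← Abelian.Ext.mk₀_comp_mk₀,
    (shortExact_of_function_exact hf hg h).extClass_comp_assoc]

end LongExactSequence

instance subsingleton_Ext_succ_of_module_projective (P : Type u) [AddCommGroup P] [Module A P]
    [Module.Projective A P] (i : ℕ) : Subsingleton (Abelian.Ext (of A P) E (i + 1)) :=
  Abelian.Ext.subsingleton_of_projective _ _ _

theorem subsingleton_Ext_of_pow_smul_eq_zero {z : A} {i : ℕ}
    (H : ∀ (N : Type u) [AddCommGroup N] [Module A N], (∀ x : N, z • x = 0) →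
      Subsingleton (Abelian.Ext (of A N) E i))
    (n : ℕ) (N : Type u) [AddCommGroup N] [Module A N] (hN : ∀ x : N, z ^ n • x = 0) :
    Subsingleton (Abelian.Ext (of A N) E i) := by
  induction n generalizing N with
  | zero => exact H N fun x ↦ by rw [← one_smul A x, ← pow_zero z, hN, smul_zero]
  | succ n ih =>
    let K := LinearMap.range (LinearMap.lsmul A N z)
    have := ih K (by
      rintro ⟨_, x, rfl⟩
      ext
      simpa [pow_succ, mul_smul] using hN x)
    have := H (N ⧸ K) (by
      rintro ⟨x⟩
      exact (Submodule.Quotient.mk_eq_zero K).2 ⟨x, rfl⟩)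
    exact subsingleton_Ext_of_exact_middle E K.injective_subtype K.mkQ_surjective
      (LinearMap.exact_subtype_mkQ K)

theorem subsingleton_Ext_range_lsmul {z : A} {i n : ℕ}
    (H : ∀ (N : Type u) [AddCommGroup N] [Module A N], (∀ x : N, z • x = 0) →
      Subsingleton (Abelian.Ext (of A N) E (i + 1)))
    (P : Type u) [AddCommGroup P] [Module A P] [Module.Projective A P]
    (hP : ∀ x : P, z ^ (n + 1) • x = 0 → z ^ n • x = 0) :
    Subsingleton (Abelian.Ext (of A (LinearMap.range (LinearMap.lsmul A P z))) E (i + 1)) := by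
  let s := (LinearMap.lsmul A P z).rangeRestrict
  let j := (LinearMap.range (LinearMap.lsmul A P (z ^ n))).subtype
  have hinj : Function.Injective (s ∘ₗ j) := by
    rw [injective_iff_map_eq_zero]
    rintro ⟨_, x, rfl⟩ h
    have : z • z ^ n • x = 0 := congr_arg Subtype.val h
    exact Subtype.ext (hP x (by rw [pow_succ', mul_smul, this]))
  have := subsingleton_Ext_of_pow_smul_eq_zero E H n (_ ⧸ LinearMap.range (s ∘ₗ j)) (by
    rintro ⟨⟨_, x, rfl⟩⟩
    refine (Submodule.Quotient.mk_eq_zero _).2 ⟨⟨_, x, rfl⟩, Subtype.ext ?_⟩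
    exact smul_comm z (z ^ n) x)
  refine subsingleton_of_forall_eq 0 fun x ↦ ?_
  obtain ⟨y, rfl⟩ := Abelian.Ext.contravariant_sequence_exact₂
    (shortExact_of_function_exact hinj (Submodule.mkQ_surjective _)
      (LinearMap.exact_map_mkQ_range _)) E x (by
        change (Abelian.Ext.mk₀ (ofHom j ≫ ofHom s)).comp x _ = 0
        rw [← Abelian.Ext.mk₀_comp_mk₀_assoc,
          Subsingleton.elim (α := Abelian.Ext (of A P) E (i + 1))
            ((Abelian.Ext.mk₀ (ofHom s)).comp x (zero_add _)) 0, Abelian.Ext.comp_zero])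
  rw [Subsingleton.elim (α := Abelian.Ext (of A (_ ⧸ LinearMap.range (s ∘ₗ j))) E (i + 1)) y 0,
    Abelian.Ext.comp_zero]

theorem subsingleton_Ext_ker_of_smul_eq_zero {z : A} {i n : ℕ}
    (H : ∀ (N : Type u) [AddCommGroup N] [Module A N], (∀ x : N, z • x = 0) →
      Subsingleton (Abelian.Ext (of A N) E (i + 1)))
    {P N : Type u} [AddCommGroup P] [Module A P] [Module.Projective A P]
    [AddCommGroup N] [Module A N] (π : P →ₗ[A] N) (hN : ∀ x : N, z • x = 0)
    (hP : ∀ x : P, z ^ (n + 1) • x = 0 → z ^ n • x = 0) :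
    Subsingleton (Abelian.Ext (of A (LinearMap.ker π)) E (i + 1)) := by
  have hle : LinearMap.range (LinearMap.lsmul A P z) ≤ LinearMap.ker π := by
    rintro _ ⟨x, rfl⟩
    simp [hN]
  have := subsingleton_Ext_range_lsmul E H P hP
  have := H (LinearMap.ker π ⧸ LinearMap.range (Submodule.inclusion hle)) (by
    rintro ⟨x⟩
    exact (Submodule.Quotient.mk_eq_zero _).2 ⟨⟨_, x, rfl⟩, rfl⟩)
  exact subsingleton_Ext_of_exact_middle E (Submodule.inclusion_injective hle)
    (Submodule.mkQ_surjective _) (LinearMap.exact_map_mkQ_range _)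

theorem subsingleton_Ext_of_smul_eq_zero [IsNoetherianRing A] {z : A}
    (H : ∀ (N : Type u) [AddCommGroup N] [Module A N], (∀ x : N, z • x = 0) →
      Subsingleton (Abelian.Ext (of A N) E 1))
    (i : ℕ) (N : Type u) [AddCommGroup N] [Module A N] (hN : ∀ x : N, z • x = 0) :
    Subsingleton (Abelian.Ext (of A N) E (i + 1)) := by
  induction i generalizing N with
  | zero => exact H N hN
  | succ i ih =>
    obtain ⟨n, hn⟩ := IsNoetherianRing.exists_forall_pow_succ_mul_eq_zero z
    let π : (N →₀ A) →ₗ[A] N := Finsupp.linearCombination A id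
    have := subsingleton_Ext_ker_of_smul_eq_zero E ih π hN
      (fun x hx ↦ Finsupp.ext fun a ↦ hn _ (DFunLike.congr_fun hx a))
    have hπ : Function.Surjective π := Finsupp.linearCombination_id_surjective A N
    exact subsingleton_Ext_succ_of_ker E hπ

section BaseCase

theorem subsingleton_Ext_one_finsupp_quotient (I : Ideal A)
    [Subsingleton (Abelian.Ext (of A (A ⧸ I)) E 1)] (ι : Type u) :
    Subsingleton (Abelian.Ext (of A (ι →₀ A ⧸ I)) E 1) := by
  classical
  have hI : Function.Exact I.subtype (Submodule.mkQ I) := LinearMap.exact_subtype_mkQ I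
  let f : (ι →₀ I) →ₗ[A] (ι →₀ A) := Finsupp.mapRange.linearMap I.subtype
  let g : (ι →₀ A) →ₗ[A] (ι →₀ A ⧸ I) := Finsupp.mapRange.linearMap (Submodule.mkQ I)
  have hf : Function.Injective f := Finsupp.mapRange_injective _ rfl I.injective_subtype
  have hg : Function.Surjective g := Finsupp.mapRange_surjective _ rfl I.mkQ_surjective
  have hfg : Function.Exact f g := by
    rw [LinearMap.exact_iff, Finsupp.ker_mapRange, Finsupp.range_mapRange_linearMap,
      hI.linearMap_ker_eq]
    exact LinearMap.ker_eq_bot.2 I.injective_subtype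
  refine subsingleton_Ext_one_of_forall_exists_comp_eq E hf hg hfg fun φ ↦ ?_
  choose ψ hψ using fun j ↦ exists_comp_eq_of_subsingleton_Ext_one I.injective_subtype
    I.mkQ_surjective hI (φ ∘ₗ Finsupp.lsingle j)
  refine ⟨Finsupp.lsum ℕ ψ, Finsupp.lhom_ext' fun j ↦ ?_⟩
  rw [← hψ]
  ext x
  simp [f]

/-- For an `A ⧸ I`-linear inclusion `f : X → Y` and `M ⧸ I • ⊤` flat over `A ⧸ I`, every
`A`-linear map from `X` to the character module of `M` extends to `Y`. -/
theorem exists_comp_eq_of_flat_quotient {I : Ideal A} {M X Y : Type u} [AddCommGroup M]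
    [Module A M] [Module.Flat (A ⧸ I) (M ⧸ (I • ⊤ : Submodule A M))]
    [AddCommGroup X] [Module A X] [Module (A ⧸ I) X] [IsScalarTower A (A ⧸ I) X]
    [AddCommGroup Y] [Module A Y] [Module (A ⧸ I) Y] [IsScalarTower A (A ⧸ I) Y]
    {f : X →ₗ[A ⧸ I] Y} (hf : Function.Injective f) (φ : X →ₗ[A] CharacterModule M) :
    ∃ ψ : Y →ₗ[A] CharacterModule M, ψ ∘ₗ f.restrictScalars A = φ := by
  let p := (I • ⊤ : Submodule A M).mkQ
  let d : CharacterModule (M ⧸ (I • ⊤ : Submodule A M)) →ₗ[A] CharacterModule M :=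
    CharacterModule.dual p
  have hd : Function.Injective d :=
    CharacterModule.dual_injective_of_surjective _ (Submodule.mkQ_surjective _)
  have hφ (x : X) : φ x ∈ LinearMap.range d := by
    refine (CharacterModule.dual_exact_iff.2 (LinearMap.exact_subtype_mkQ _) _).1 ?_
    ext ⟨m, hm⟩
    change φ x m = 0
    refine Submodule.smul_induction_on hm (fun r hr n _ ↦ ?_)
      fun a b ha hb ↦ by rw [map_add, ha, hb, add_zero]
    have : r • x = 0 := by
      rw [← algebraMap_smul (A ⧸ I) r x, Ideal.Quotient.algebraMap_eq,
        Ideal.Quotient.eq_zero_iff_mem.2 hr, zero_smul]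
    change (r • φ x) n = 0
    rw [← map_smul, this, map_zero]
    rfl
  have : IsScalarTower A (A ⧸ I) (CharacterModule (M ⧸ (I • ⊤ : Submodule A M))) :=
    ⟨fun a b c ↦ by
      ext m
      change c ((a • b) • m) = c (b • a • m)
      rw [smul_assoc, smul_comm]⟩
  let φ' : X →ₗ[A] CharacterModule (M ⧸ (I • ⊤ : Submodule A M)) :=
    (LinearEquiv.ofInjective d hd).symm ∘ₗ φ.codRestrict (LinearMap.range d) hφ
  have hφ' (x : X) : d (φ' x) = φ x :=
    congr_arg Subtype.val ((LinearEquiv.ofInjective d hd).apply_symm_apply ⟨φ x, hφ x⟩)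
  obtain ⟨χ, hχ⟩ := (Module.Flat.iff_characterModule_baer.1 ‹_›).extension_property f hf
    (φ'.extendScalarsOfSurjective Ideal.Quotient.mk_surjective)
  refine ⟨d ∘ₗ χ.restrictScalars A, LinearMap.ext fun x ↦ ?_⟩
  rw [← hφ']
  exact congr_arg d (LinearMap.congr_fun hχ x)

theorem subsingleton_Ext_one_characterModule_of_surjective {I : Ideal A} {M F N : Type u}
    [AddCommGroup M] [Module A M] [Module.Flat (A ⧸ I) (M ⧸ (I • ⊤ : Submodule A M))]
    [AddCommGroup F] [Module A F] [Module (A ⧸ I) F] [IsScalarTower A (A ⧸ I) F]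
    [AddCommGroup N] [Module A N] [Module (A ⧸ I) N] [IsScalarTower A (A ⧸ I) N]
    [Subsingleton (Abelian.Ext (of A F) (of A (CharacterModule M)) 1)]
    {π : F →ₗ[A ⧸ I] N} (hπ : Function.Surjective π) :
    Subsingleton (Abelian.Ext (of A N) (of A (CharacterModule M)) 1) :=
  have hker : Function.Injective (LinearMap.ker π).subtype := (LinearMap.ker π).injective_subtype
  subsingleton_Ext_one_of_forall_exists_comp_eq (of A (CharacterModule M))
    (f := (LinearMap.ker π).subtype.restrictScalars A) (g := π.restrictScalars A) hker hπ
    (LinearMap.exact_subtype_ker_map π) fun φ ↦ exists_comp_eq_of_flat_quotient hker φ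

theorem subsingleton_Ext_one_characterModule {I : Ideal A} (M : Type u) [AddCommGroup M]
    [Module A M] [Module.Flat (A ⧸ I) (M ⧸ (I • ⊤ : Submodule A M))]
    [Subsingleton (Abelian.Ext (of A (A ⧸ I)) (of A (CharacterModule M)) 1)]
    (N : Type u) [AddCommGroup N] [Module A N] [Module (A ⧸ I) N] [IsScalarTower A (A ⧸ I) N] :
    Subsingleton (Abelian.Ext (of A N) (of A (CharacterModule M)) 1) := by
  have := subsingleton_Ext_one_finsupp_quotient (of A (CharacterModule M)) I N
  have hπ : Function.Surjective (Finsupp.linearCombination (A ⧸ I) (id : N → N)) :=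
    Finsupp.linearCombination_id_surjective (A ⧸ I) N
  exact subsingleton_Ext_one_characterModule_of_surjective hπ

end BaseCase

end ModuleCat

theorem tor_vanishing_mod_element
    (A : Type) [CommRing A] [IsNoetherianRing A] (M : Type) [AddCommGroup M] [Module A M]
    (z : A) (hz : z ≠ 0)
    (htor : Subsingleton (((Tor (ModuleCat A) 1).obj
        (ModuleCat.of A M)).obj (ModuleCat.of A (A ⧸ Ideal.span {z}))))
    (hflat : Module.Flat (A ⧸ Ideal.span {z})
        (M ⧸ ((Ideal.span {z} : Ideal A) • ⊤ : Submodule A M))) :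
    ∀ (N : Type) [AddCommGroup N] [Module A N], (∀ x : N, z • x = 0) →
      ∀ i : ℕ, 1 ≤ i →
        Subsingleton (((Tor (ModuleCat A) i).obj
          (ModuleCat.of A M)).obj (ModuleCat.of A N)) := by
  intro N _ _ hN i hi
  obtain ⟨i, rfl⟩ := Nat.exists_eq_add_of_le' hi
  rw [ModuleCat.subsingleton_Tor_succ_iff_subsingleton_Ext] at htor ⊢
  refine ModuleCat.subsingleton_Ext_of_smul_eq_zero _ (fun N _ _ hN ↦ ?_) i N hN
  have hN' : Module.IsTorsionBySet A N (Ideal.span {z} : Ideal A) :=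
    (Module.isTorsionBySet_span_singleton_iff z).2 hN
  let := hN'.module
  have : IsScalarTower A (A ⧸ Ideal.span {z}) N := hN'.isScalarTower
  exact ModuleCat.subsingleton_Ext_one_characterModule (I := Ideal.span {z}) M N
end

section
/- Let R be a commutative noetherian ring, R → A a ring homomorphism, and φ : M → N an A-linear map of A-modules, where N is flat over A. Then φ is a pure map of A-modules if and only if for every prime ideal p of R: (i) the map φ ⊗_A (A/pA) : M ⊗_A (A/pA) → N ⊗_A (A/pA) is injective; (ii) the map φ ⊗_A (A/pA)_tf : M ⊗_A (A/pA)_tf → N ⊗_A (A/pA)_tf is injective; and (iii) the map φ ⊗_R k(p) : M ⊗_R k(p) → N ⊗_R k(p) is a pure map of (A ⊗_R k(p))-modules. -/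
/-!
Proposition 5.3 (fiber criterion for pure maps): let `R` be noetherian, `R → A` a ring map and
`φ : M → N` an `A`-linear map with `N` flat over `A`.  Then `φ` is pure (i.e. `φ ⊗ id_E` is
injective for every `A`-module `E`) if and only if for every prime `p` of `R`:
(i) `φ ⊗_A (A/pA)` is injective;
(ii) `φ ⊗_A (A/pA)_tf` is injective, where `(A/pA)_tf` is the quotient of `A/pA` by its
`R/p`-torsion submodule;
(iii) the base change of `φ` to `A ⊗_R k(p)` (with `k(p) = Frac(R ⧸ p)`), which realizes
`φ ⊗_R k(p) : M ⊗_R k(p) → N ⊗_R k(p)`, is a pure map of `(A ⊗_R k(p))`-modules.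
-/

set_option synthInstance.maxHeartbeats 1000000
set_option maxHeartbeats 2000000

open TensorProduct

/-- The torsion of `N` with respect to the domain `R ⧸ p` (acting through `f : R →+* B`),
as a `B`-submodule of `N`. -/
def relTorsion (R : Type) [CommRing R] (p : Ideal R) (hp : p.IsPrime)
    (B : Type) [CommRing B] (f : R →+* B)
    (N : Type) [AddCommGroup N] [Module B N] : Submodule B N where
  carrier := {x | ∃ r : R, r ∉ p ∧ f r • x = 0}
  zero_mem' := ⟨1, fun h => hp.ne_top ((Ideal.eq_top_iff_one p).mpr h), smul_zero _⟩
  add_mem' := by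
    rintro x y ⟨r, hr, hrx⟩ ⟨s, hs, hsy⟩
    refine ⟨r * s, fun h => (hp.mem_or_mem h).elim hr hs, ?_⟩
    have h1 : (f r * f s) • x = 0 := by rw [mul_comm, mul_smul, hrx, smul_zero]
    have h2 : (f r * f s) • y = 0 := by rw [mul_smul, hsy, smul_zero]
    rw [map_mul, smul_add, h1, h2, add_zero]
  smul_mem' := by
    rintro b x ⟨r, hr, hrx⟩
    refine ⟨r, hr, ?_⟩
    rw [smul_smul, mul_comm, ← smul_smul, hrx, smul_zero]

section Purity

variable {A M N : Type} [CommRing A] [AddCommGroup M] [AddCommGroup N] [Module A M] [Module A N]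
  (φ : M →ₗ[A] N)

theorem rTensor_lTensor_comm {E F : Type} [AddCommGroup E] [Module A E] [AddCommGroup F]
    [Module A F] (f : E →ₗ[A] F) (x : M ⊗[A] E) :
    φ.rTensor F (f.lTensor M x) = f.lTensor N (φ.rTensor E x) := by
  rw [← LinearMap.comp_apply, ← LinearMap.comp_apply, LinearMap.rTensor_comp_lTensor,
    LinearMap.lTensor_comp_rTensor]

theorem lTensor_lsmul_apply {E : Type} [AddCommGroup E] [Module A E] (a : A) (x : M ⊗[A] E) :
    (LinearMap.lsmul A E a).lTensor M x = a • x := by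
  have h : LinearMap.lsmul A E a = a • LinearMap.id := rfl
  rw [h, LinearMap.lTensor_smul, LinearMap.lTensor_id]
  rfl

/-- For flat `N`, the modules `E` for which `φ ⊗ E` is injective are closed under extensions. -/
theorem rTensor_injective_of_extension [Module.Flat A N] {E : Type} [AddCommGroup E] [Module A E]
    (E' : Submodule A E) (h₁ : Function.Injective (φ.rTensor E'))
    (h₂ : Function.Injective (φ.rTensor (E ⧸ E'))) : Function.Injective (φ.rTensor E) := by
  rw [injective_iff_map_eq_zero]
  intro x hx
  have hq : E'.mkQ.lTensor M x = 0 := by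
    apply h₂
    rw [rTensor_lTensor_comm, hx, map_zero, map_zero]
  obtain ⟨y, rfl⟩ := (lTensor_exact M (LinearMap.exact_subtype_mkQ E') E'.mkQ_surjective x).1 hq
  have hy : y = 0 := by
    apply h₁
    apply Module.Flat.lTensor_preserves_injective_linearMap (M := N) E'.subtype E'.injective_subtype
    rw [← rTensor_lTensor_comm, hx, map_zero, map_zero]
  rw [hy, map_zero]

/-- If every element of `E` is killed by an element of a multiplicative set `S`, injectivity of
`φ ⊗ E` can be checked on the submodules of elements killed by a fixed element of `S`. -/
theorem rTensor_injective_of_torsion [Module.Flat A N] {E : Type} [AddCommGroup E] [Module A E]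
    (S : Submonoid A) (hE : ∀ e : E, ∃ s ∈ S, s • e = 0)
    (h : ∀ s ∈ S, Function.Injective (φ.rTensor (Submodule.torsionBy A E s))) :
    Function.Injective (φ.rTensor E) := by
  have key : ∀ x : M ⊗[A] E, ∃ s ∈ S, ∃ y,
      (Submodule.torsionBy A E s).subtype.lTensor M y = x := by
    have mono : ∀ {s t : A}, s ∣ t → ∀ y, ∃ z,
        (Submodule.torsionBy A E t).subtype.lTensor M z =
          (Submodule.torsionBy A E s).subtype.lTensor M y := by
      intro s t hst y
      have hle := Submodule.torsionBy_le_torsionBy_of_dvd (M := E) s t hst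
      refine ⟨(Submodule.inclusion hle).lTensor M y, ?_⟩
      rw [← LinearMap.lTensor_comp_apply, Submodule.subtype_comp_inclusion]
    intro x
    induction x using TensorProduct.induction_on with
    | zero => exact ⟨1, S.one_mem, 0, map_zero _⟩
    | tmul m e =>
      obtain ⟨s, hs, he⟩ := hE e
      exact ⟨s, hs, m ⊗ₜ ⟨e, (Submodule.mem_torsionBy_iff s e).2 he⟩, by simp⟩
    | add x y hx hy =>
      obtain ⟨s, hs, u, rfl⟩ := hx
      obtain ⟨t, ht, v, rfl⟩ := hy
      obtain ⟨u', hu⟩ := mono (dvd_mul_right s t) u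
      obtain ⟨v', hv⟩ := mono (dvd_mul_left t s) v
      exact ⟨s * t, S.mul_mem hs ht, u' + v', by rw [map_add, hu, hv]⟩
  rw [injective_iff_map_eq_zero]
  intro x hx
  obtain ⟨s, hs, y, rfl⟩ := key x
  have hy : y = 0 := by
    apply h s hs
    apply Module.Flat.lTensor_preserves_injective_linearMap (M := N)
      (Submodule.torsionBy A E s).subtype (Submodule.injective_subtype _)
    rw [← rTensor_lTensor_comm, hx, map_zero, map_zero]
  rw [hy, map_zero]

theorem rTensor_finsupp_injective (ι : Type) {E : Type} [AddCommGroup E] [Module A E]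
    (h : Function.Injective (φ.rTensor E)) : Function.Injective (φ.rTensor (ι →₀ E)) := by
  classical
  rw [injective_iff_map_eq_zero]
  intro x hx
  apply (TensorProduct.finsuppRight A A M E ι).injective
  rw [map_zero]
  ext1 i
  rw [TensorProduct.finsuppRight_apply, Finsupp.coe_zero, Pi.zero_apply]
  apply h
  rw [map_zero]
  exact (rTensor_lTensor_comm φ (Finsupp.lapply i) x).trans (by rw [hx, map_zero])

/-- Let `0 → K → F → E → 0` be exact with `a` regular on `E` and `F`. If `φ ⊗ F` and
`φ ⊗ K / a K` are injective, then `a` is regular on `M ⊗ E`. -/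
theorem eq_zero_of_smul_eq_zero_of_presentation [Module.Flat A N] {E F : Type}
    [AddCommGroup E] [Module A E] [AddCommGroup F] [Module A F]
    (g : F →ₗ[A] E) (hg : Function.Surjective g) (a : A)
    (haE : ∀ e : E, a • e = 0 → e = 0) (haF : ∀ f : F, a • f = 0 → f = 0)
    (hF : Function.Injective (φ.rTensor F))
    (hK : Function.Injective (φ.rTensor
      (LinearMap.ker g ⧸ LinearMap.range (LinearMap.lsmul A (LinearMap.ker g) a))))
    (x : M ⊗[A] E) (hx : a • x = 0) : x = 0 := by
  have hMF : ∀ y : M ⊗[A] F, a • y = 0 → y = 0 := by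
    intro y hy
    apply hF
    apply Module.Flat.lTensor_preserves_injective_linearMap (M := N) (LinearMap.lsmul A F a)
      ((injective_iff_map_eq_zero _).2 haF)
    rw [lTensor_lsmul_apply, ← map_smul, hy, map_zero, map_zero]
  set K := LinearMap.ker g
  set aK := LinearMap.range (LinearMap.lsmul A K a)
  set aF := LinearMap.range (LinearMap.lsmul A F a)
  have hex : Function.Exact K.subtype g := LinearMap.exact_subtype_ker_map g
  obtain ⟨y, rfl⟩ := LinearMap.lTensor_surjective M hg x
  rw [← map_smul] at hx
  obtain ⟨z, hz⟩ := (lTensor_exact M hex hg _).1 hx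
  have hle : aK ≤ aF.comap K.subtype := by
    rintro _ ⟨k, rfl⟩
    exact ⟨k, rfl⟩
  have hinj : Function.Injective (aK.mapQ aF K.subtype hle) := by
    rw [← LinearMap.ker_eq_bot, Submodule.ker_mapQ, ← le_bot_iff,
      Submodule.map_le_iff_le_comap, Submodule.comap_bot, Submodule.ker_mkQ]
    rintro k ⟨f, hf⟩
    have hf' : a • f = k := hf
    refine ⟨⟨f, haE _ ?_⟩, Subtype.ext hf⟩
    rw [← map_smul, hf']
    exact k.2
  have hmk : aK.mkQ.lTensor M z = 0 := by
    have h₀ : (aK.mapQ aF K.subtype hle).lTensor M (aK.mkQ.lTensor M z) = 0 := by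
      rw [← LinearMap.lTensor_comp_apply, Submodule.mapQ_mkQ, LinearMap.lTensor_comp_apply, hz,
        ← lTensor_lsmul_apply, ← LinearMap.lTensor_comp_apply, LinearMap.range_mkQ_comp,
        LinearMap.lTensor_zero, LinearMap.zero_apply]
    apply hK
    apply Module.Flat.lTensor_preserves_injective_linearMap (M := N) _ hinj
    rw [← rTensor_lTensor_comm, h₀, map_zero, map_zero, map_zero]
  obtain ⟨w, hw⟩ := (lTensor_exact M (LinearMap.exact_map_mkQ_range (LinearMap.lsmul A K a))
    (Submodule.mkQ_surjective _) z).1 hmk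
  have hyw : y = K.subtype.lTensor M w := by
    rw [← sub_eq_zero]
    apply hMF
    rw [smul_sub, ← hz, ← hw, lTensor_lsmul_apply, map_smul, sub_self]
  rw [hyw, ← LinearMap.lTensor_comp_apply, hex.linearMap_comp_eq_zero,
    LinearMap.lTensor_zero, LinearMap.zero_apply]

/-- Purity is stable under base change. -/
theorem baseChange_pure_of_pure (B : Type) [CommRing B] [Algebra A B]
    (h : ∀ (E : Type) [AddCommGroup E] [Module A E], Function.Injective (φ.rTensor E))
    (E : Type) [AddCommGroup E] [Module B E] :
    Function.Injective ((φ.baseChange B).rTensor E) := by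
  let : Module A E := Module.compHom E (algebraMap A B)
  have : IsScalarTower A B E := ⟨fun a b e => by
    rw [Algebra.smul_def, mul_smul]; rfl⟩
  let eM := (TensorProduct.comm B (B ⊗[A] M) E).trans
    (TensorProduct.AlgebraTensorModule.cancelBaseChange A B B E M)
  let eN := (TensorProduct.comm B (B ⊗[A] N) E).trans
    (TensorProduct.AlgebraTensorModule.cancelBaseChange A B B E N)
  have hc : ∀ x, eN ((φ.baseChange B).rTensor E x) = φ.lTensor E (eM x) := by
    intro x
    induction x using TensorProduct.induction_on with
    | zero => simp
    | add x y hx hy => simp only [map_add, hx, hy]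
    | tmul t e =>
      induction t using TensorProduct.induction_on with
      | zero => simp
      | add x y hx hy => simp only [TensorProduct.add_tmul, map_add, hx, hy]
      | tmul b m => simp [eM, eN]
  have hl : Function.Injective (φ.lTensor E) :=
    (LinearMap.lTensor_inj_iff_rTensor_inj E φ).2 (h E)
  intro x y hxy
  apply eM.injective
  apply hl
  rw [← hc, ← hc, hxy]

/-- If the base change of `φ` to `B` is pure, then `B ⊗ φ ⊗ E` is injective. -/
theorem lTensor_rTensor_injective_of_baseChange_pure (B : Type) [CommRing B] [Algebra A B]
    (h : ∀ (E : Type) [AddCommGroup E] [Module B E],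
      Function.Injective ((φ.baseChange B).rTensor E))
    (E : Type) [AddCommGroup E] [Module A E] :
    Function.Injective ((φ.rTensor E).lTensor B) := by
  let eM := TensorProduct.AlgebraTensorModule.distribBaseChange A B M E
  let eN := TensorProduct.AlgebraTensorModule.distribBaseChange A B N E
  have hc : ∀ x, eN ((φ.rTensor E).lTensor B x) =
      (φ.baseChange B).rTensor (B ⊗[A] E) (eM x) := by
    intro x
    induction x using TensorProduct.induction_on with
    | zero => simp
    | add x y hx hy => simp only [map_add, hx, hy]
    | tmul b t =>
      induction t using TensorProduct.induction_on with
      | zero => simp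
      | add x y hx hy => simp only [TensorProduct.tmul_add, map_add, hx, hy]
      | tmul m e => simp [eM, eN]
  intro x y hxy
  apply eM.injective
  apply h
  rw [← hc, ← hc, hxy]

end Purity

section Fibers

variable {R A : Type} [CommRing R] [CommRing A] [Algebra R A]

/-- An element of an `A/pA`-module that vanishes in the fiber over `p` is torsion. -/
theorem exists_smul_eq_zero_of_tmul_eq_zero (p : Ideal R) [hp : p.IsPrime] {X : Type}
    [AddCommGroup X] [Module A X] (hX : p ≤ (Module.annihilator A X).comap (algebraMap R A))
    (x : X) (hx : (1 : A ⊗[R] FractionRing (R ⧸ p)) ⊗ₜ[A] x = 0) :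
    ∃ r ∉ p, algebraMap R A r • x = 0 := by
  let : Module R X := Module.compHom X (algebraMap R A)
  have : IsScalarTower R A X := ⟨fun r a x => by rw [Algebra.smul_def, mul_smul]; rfl⟩
  have htor : Module.IsTorsionBySet R X p := fun x r =>
    Module.mem_annihilator.1 (hX r.2) x
  let : Module (R ⧸ p) X := htor.module
  have : IsScalarTower R (R ⧸ p) X := htor.isScalarTower
  have h₁ := congrArg (TensorProduct.comm A _ X) hx
  rw [TensorProduct.comm_tmul, map_zero, Algebra.TensorProduct.one_def] at h₁
  have h₂ := congrArg (TensorProduct.AlgebraTensorModule.cancelBaseChange R A A X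
    (FractionRing (R ⧸ p))) h₁
  rw [TensorProduct.AlgebraTensorModule.cancelBaseChange_tmul, map_zero, one_smul] at h₂
  have h₃ := congrArg (TensorProduct.mapOfCompatibleSMul (R ⧸ p) R R X (FractionRing (R ⧸ p))) h₂
  rw [TensorProduct.mapOfCompatibleSMul_tmul, map_zero] at h₃
  have h₄ := congrArg (TensorProduct.comm (R ⧸ p) _ _) h₃
  rw [TensorProduct.comm_tmul, map_zero] at h₄
  obtain ⟨d, hd⟩ := (IsLocalizedModule.eq_zero_iff (nonZeroDivisors (R ⧸ p))
    (TensorProduct.mk (R ⧸ p) (FractionRing (R ⧸ p)) X 1)).1 h₄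
  obtain ⟨r, hr⟩ := Ideal.Quotient.mk_surjective (d : R ⧸ p)
  refine ⟨r, fun hrp => nonZeroDivisors.coe_ne_zero d ?_, ?_⟩
  · rw [← hr, Ideal.Quotient.eq_zero_iff_mem.2 hrp]
  · have : (d : R ⧸ p) • x = 0 := hd
    rw [← hr] at this
    exact this

variable {M N : Type} [AddCommGroup M] [AddCommGroup N] [Module A M] [Module A N]
  (φ : M →ₗ[A] N)

/-- The torsionfree quotient `(A/pA)_tf`. -/
abbrev torsionfreeFiber (A : Type) [CommRing A] [Algebra R A] (p : Ideal R) (hp : p.IsPrime) :=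
  (A ⧸ Ideal.map (algebraMap R A) p) ⧸
    relTorsion R p hp A (algebraMap R A) (A ⧸ Ideal.map (algebraMap R A) p)

theorem eq_zero_of_smul_eq_zero_relTorsion (p : Ideal R) (hp : p.IsPrime) {E : Type}
    [AddCommGroup E] [Module A E] {r : R} (hr : r ∉ p)
    (x : E ⧸ relTorsion R p hp A (algebraMap R A) E) (hx : algebraMap R A r • x = 0) : x = 0 := by
  obtain ⟨e, rfl⟩ := Submodule.mkQ_surjective _ x
  rw [← map_smul, Submodule.mkQ_apply, Submodule.Quotient.mk_eq_zero] at hx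
  obtain ⟨s, hs, hse⟩ := hx
  rw [Submodule.mkQ_apply, Submodule.Quotient.mk_eq_zero]
  refine ⟨s * r, fun h => (hp.mem_or_mem h).elim hs hr, ?_⟩
  rw [map_mul, mul_smul, hse]

/-- A torsionfree module over `A/pA` is a quotient of a free module over `(A/pA)_tf`. -/
theorem exists_surjective_of_torsionfree (p : Ideal R) (hp : p.IsPrime) {E : Type}
    [AddCommGroup E] [Module A E] (hE : p ≤ (Module.annihilator A E).comap (algebraMap R A))
    (htf : ∀ r ∉ p, ∀ e : E, algebraMap R A r • e = 0 → e = 0) :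
    ∃ g : (E →₀ torsionfreeFiber A p hp) →ₗ[A] E, Function.Surjective g := by
  have h₁ : ∀ e : E, Ideal.map (algebraMap R A) p ≤
      LinearMap.ker (LinearMap.toSpanSingleton A E e) :=
    fun e => Ideal.map_le_iff_le_comap.2 fun r hr => Module.mem_annihilator.1 (hE hr) e
  have h₂ : ∀ e : E, relTorsion R p hp A (algebraMap R A) (A ⧸ Ideal.map (algebraMap R A) p) ≤
      LinearMap.ker (Submodule.liftQ _ _ (h₁ e)) := by
    rintro e x ⟨r, hr, hrx⟩
    refine htf r hr _ ?_
    rw [← map_smul, hrx, map_zero]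
  refine ⟨Finsupp.lsum A fun e => Submodule.liftQ _ _ (h₂ e), fun e =>
    ⟨Finsupp.single e (Submodule.Quotient.mk (Submodule.Quotient.mk 1)), ?_⟩⟩
  rw [Finsupp.lsum_single]
  exact one_smul A e

theorem le_comap_annihilator_submodule {I : Ideal R} {E : Type} [AddCommGroup E] [Module A E]
    (h : I ≤ (Module.annihilator A E).comap (algebraMap R A)) (E' : Submodule A E) :
    I ≤ (Module.annihilator A E').comap (algebraMap R A) :=
  h.trans (Ideal.comap_mono (E'.subtype.annihilator_le_of_injective E'.injective_subtype))

theorem le_comap_annihilator_quotient {I : Ideal R} {E : Type} [AddCommGroup E] [Module A E]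
    (h : I ≤ (Module.annihilator A E).comap (algebraMap R A)) (E' : Submodule A E) :
    I ≤ (Module.annihilator A (E ⧸ E')).comap (algebraMap R A) :=
  h.trans (Ideal.comap_mono (E'.mkQ.annihilator_le_of_surjective E'.mkQ_surjective))

/-- If `φ ⊗ E` is injective for all modules over `A/pA` killed by some `r ∉ p`, then the
conditions on the fiber at `p` give injectivity of `φ ⊗ E` for all torsionfree modules `E` over
`A/pA`. -/
theorem rTensor_injective_of_torsionfree [Module.Flat A N] (p : Ideal R) [hp : p.IsPrime]
    (hlarge : ∀ r ∉ p, ∀ (E : Type) [AddCommGroup E] [Module A E],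
      p ≤ (Module.annihilator A E).comap (algebraMap R A) →
      r ∈ (Module.annihilator A E).comap (algebraMap R A) → Function.Injective (φ.rTensor E))
    (htf : Function.Injective (φ.rTensor (torsionfreeFiber A p hp)))
    (hfib : ∀ (E : Type) [AddCommGroup E] [Module (A ⊗[R] FractionRing (R ⧸ p)) E],
      Function.Injective ((φ.baseChange (A ⊗[R] FractionRing (R ⧸ p))).rTensor E))
    (E : Type) [AddCommGroup E] [Module A E]
    (hE : p ≤ (Module.annihilator A E).comap (algebraMap R A))
    (hreg : ∀ r ∉ p, ∀ e : E, algebraMap R A r • e = 0 → e = 0) :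
    Function.Injective (φ.rTensor E) := by
  rw [injective_iff_map_eq_zero]
  intro x hx
  have hX : p ≤ (Module.annihilator A (M ⊗[A] E)).comap (algebraMap R A) := by
    refine fun r hr => Module.mem_annihilator.2 fun t => ?_
    have h₀ : LinearMap.lsmul A E (algebraMap R A r) = 0 :=
      LinearMap.ext (Module.mem_annihilator.1 (hE hr))
    rw [← lTensor_lsmul_apply, h₀, LinearMap.lTensor_zero, LinearMap.zero_apply]
  obtain ⟨r, hr, hrx⟩ := exists_smul_eq_zero_of_tmul_eq_zero p hX x (by
    apply lTensor_rTensor_injective_of_baseChange_pure φ _ hfib E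
    rw [LinearMap.lTensor_tmul, hx, TensorProduct.tmul_zero, map_zero])
  obtain ⟨g, hg⟩ := exists_surjective_of_torsionfree p hp hE hreg
  have hF : p ≤ (Module.annihilator A (E →₀ torsionfreeFiber A p hp)).comap (algebraMap R A) := by
    have hQ : p ≤ (Module.annihilator A (A ⧸ Ideal.map (algebraMap R A) p)).comap
        (algebraMap R A) := by
      rw [Ideal.annihilator_quotient]
      exact Ideal.le_comap_map
    refine fun s hs => Module.mem_annihilator.2 fun f => Finsupp.ext fun e => ?_
    have hs' : algebraMap R A s ∈ Module.annihilator A (torsionfreeFiber A p hp) :=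
      le_comap_annihilator_quotient hQ _ hs
    rw [Finsupp.smul_apply]
    exact Module.mem_annihilator.1 hs' (f e)
  have hK : ∀ (K : Type) [AddCommGroup K] [Module A K],
      p ≤ (Module.annihilator A K).comap (algebraMap R A) → Function.Injective
        (φ.rTensor (K ⧸ LinearMap.range (LinearMap.lsmul A K (algebraMap R A r)))) := by
    intro K _ _ h
    refine hlarge r hr _ (le_comap_annihilator_quotient h _)
      (Module.mem_annihilator.2 fun k => ?_)
    obtain ⟨k, rfl⟩ := Submodule.mkQ_surjective _ k
    rw [← map_smul, Submodule.mkQ_apply, Submodule.Quotient.mk_eq_zero]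
    exact ⟨k, rfl⟩
  refine eq_zero_of_smul_eq_zero_of_presentation φ g hg (algebraMap R A r) (hreg r hr) ?_
    (rTensor_finsupp_injective φ E htf) ?_ x hrx
  · intro f hf
    ext1 e
    exact eq_zero_of_smul_eq_zero_relTorsion p hp hr (f e) (DFunLike.congr_fun hf e)
  · exact hK _ (le_comap_annihilator_submodule hF _)

/-- The inductive step at a prime `p`: if `φ ⊗ E` is injective for all modules over `A/pA` killed
by some `r ∉ p`, then the conditions on the fiber at `p` give injectivity of `φ ⊗ E` for all
modules `E` over `A/pA`. -/
theorem rTensor_injective_of_prime [Module.Flat A N] (p : Ideal R) [hp : p.IsPrime]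
    (hlarge : ∀ r ∉ p, ∀ (E : Type) [AddCommGroup E] [Module A E],
      p ≤ (Module.annihilator A E).comap (algebraMap R A) →
      r ∈ (Module.annihilator A E).comap (algebraMap R A) → Function.Injective (φ.rTensor E))
    (htf : Function.Injective (φ.rTensor (torsionfreeFiber A p hp)))
    (hfib : ∀ (E : Type) [AddCommGroup E] [Module (A ⊗[R] FractionRing (R ⧸ p)) E],
      Function.Injective ((φ.baseChange (A ⊗[R] FractionRing (R ⧸ p))).rTensor E))
    (E : Type) [AddCommGroup E] [Module A E]
    (hE : p ≤ (Module.annihilator A E).comap (algebraMap R A)) :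
    Function.Injective (φ.rTensor E) := by
  apply rTensor_injective_of_extension φ (relTorsion R p hp A (algebraMap R A) E)
  · apply rTensor_injective_of_torsion φ (p.primeCompl.map (algebraMap R A))
    · rintro ⟨e, r, hr, hre⟩
      exact ⟨_, ⟨r, hr, rfl⟩, Subtype.ext hre⟩
    · rintro _ ⟨r, hr, rfl⟩
      refine hlarge r hr _ (le_comap_annihilator_submodule
        (le_comap_annihilator_submodule hE _) _) (Module.mem_annihilator.2 fun e => ?_)
      exact Submodule.smul_torsionBy _ e
  · exact rTensor_injective_of_torsionfree φ p hlarge htf hfib _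
      (le_comap_annihilator_quotient hE _)
      fun r hr => eq_zero_of_smul_eq_zero_relTorsion p hp hr

/-- Noetherian induction reduces injectivity of `φ ⊗ E` for all `E` to the inductive step at
primes of `R`. -/
theorem rTensor_injective_of_fibers [IsNoetherianRing R] [Module.Flat A N]
    (htf : ∀ (p : Ideal R) [hp : p.IsPrime],
      Function.Injective (φ.rTensor (torsionfreeFiber A p hp)))
    (hfib : ∀ (p : Ideal R) [p.IsPrime] (E : Type) [AddCommGroup E]
      [Module (A ⊗[R] FractionRing (R ⧸ p)) E],
      Function.Injective ((φ.baseChange (A ⊗[R] FractionRing (R ⧸ p))).rTensor E))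
    (I : Ideal R) (E : Type) [AddCommGroup E] [Module A E]
    (hE : I ≤ (Module.annihilator A E).comap (algebraMap R A)) :
    Function.Injective (φ.rTensor E) := by
  induction I using WellFoundedGT.induction generalizing E with
  | ind I ih =>
  have ih' : ∀ r ∉ I, ∀ (E : Type) [AddCommGroup E] [Module A E],
      I ≤ (Module.annihilator A E).comap (algebraMap R A) →
      r ∈ (Module.annihilator A E).comap (algebraMap R A) →
      Function.Injective (φ.rTensor E) := by
    intro r hr E _ _ hE hrE
    refine ih (I ⊔ Ideal.span {r}) ?_ E (sup_le hE ((Ideal.span_singleton_le_iff_mem _).2 hrE))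
    exact left_lt_sup.2 fun h => hr (h (Ideal.mem_span_singleton_self r))
  by_cases hI : I.IsPrime
  · exact rTensor_injective_of_prime φ I ih' (htf I) (hfib I) E hE
  rcases Ideal.not_isPrime_iff.1 hI with rfl | ⟨a, ha, b, hb, hab⟩
  · have h₁ : (1 : A) ∈ Module.annihilator A E := by
      simpa using hE (Submodule.mem_top (x := (1 : R)))
    have : Subsingleton E := subsingleton_of_forall_eq 0 fun e => by
      simpa using Module.mem_annihilator.1 h₁ e
    exact Function.injective_of_subsingleton _
  · apply rTensor_injective_of_extension φ (Submodule.torsionBy A E (algebraMap R A a))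
    · exact ih' a ha _ (le_comap_annihilator_submodule hE _)
        (Module.mem_annihilator.2 fun e => Submodule.smul_torsionBy _ e)
    · refine ih' b hb _ (le_comap_annihilator_quotient hE _)
        (Module.mem_annihilator.2 fun e => ?_)
      obtain ⟨e, rfl⟩ := Submodule.mkQ_surjective _ e
      rw [← map_smul, Submodule.mkQ_apply, Submodule.Quotient.mk_eq_zero,
        Submodule.mem_torsionBy_iff, smul_smul, ← map_mul]
      exact Module.mem_annihilator.1 (hE hab) e

end Fibers

theorem fiber_criterion_for_pure_maps
    (R A : Type) [CommRing R] [IsNoetherianRing R] [CommRing A] [Algebra R A]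
    (M N : Type) [AddCommGroup M] [AddCommGroup N] [Module A M] [Module A N]
    (φ : M →ₗ[A] N) [Module.Flat A N] :
    (∀ (E : Type) [AddCommGroup E] [Module A E],
        Function.Injective (LinearMap.rTensor E φ)) ↔
      ∀ (p : Ideal R) [hp : p.IsPrime],
        Function.Injective (LinearMap.rTensor (A ⧸ Ideal.map (algebraMap R A) p) φ) ∧
        Function.Injective (LinearMap.rTensor
          ((A ⧸ Ideal.map (algebraMap R A) p) ⧸
            relTorsion R p hp A (algebraMap R A) (A ⧸ Ideal.map (algebraMap R A) p)) φ) ∧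
        (∀ (E : Type) [AddCommGroup E] [Module (A ⊗[R] FractionRing (R ⧸ p)) E],
          Function.Injective (LinearMap.rTensor (R := A ⊗[R] FractionRing (R ⧸ p)) E
            (LinearMap.baseChange (A ⊗[R] FractionRing (R ⧸ p)) φ))) := by
  constructor
  · intro h p hp
    exact ⟨h _, h _, baseChange_pure_of_pure φ _ h⟩
  · intro h E _ _
    exact rTensor_injective_of_fibers φ (fun p _ => (h p).2.1) (fun p _ => (h p).2.2) (⊥ : Ideal R)
      E bot_le
end

section
/- Let R be a commutative noetherian ring and R → A a ring homomorphism such that for every prime ideal p of R, A/pA is a torsionfree (R/p)-module. Let φ : M → N be an A-linear map of A-modules with N flat over A. Then φ is a pure map of A-modules if and only if for every prime ideal p of R, M/pM is a torsionfree (R/p)-module and φ ⊗_R k(p) : M ⊗_R k(p) → N ⊗_R k(p) is a pure map of (A ⊗_R k(p))-modules. -/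
/-!
Corollary 5.4: let `R` be noetherian and `R → A` a ring map such that `A/pA` is a torsionfree
`R/p`-module for every prime `p` of `R`.  Let `φ : M → N` be an `A`-linear map with `N` flat
over `A`.  Then `φ` is pure (i.e. `φ ⊗ id_E` is injective for every `A`-module `E`) if and
only if, for every prime `p` of `R`, the `R/p`-module `M/pM` is torsionfree and the base
change of `φ` to `A ⊗_R k(p)` (realizing `φ ⊗_R k(p)`, with `k(p) = Frac(R ⧸ p)`) is a pure
map of `(A ⊗_R k(p))`-modules.
-/

set_option synthInstance.maxHeartbeats 1000000
set_option maxHeartbeats 2000000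

open TensorProduct

/-- Injectivity of the base change of `φ` tensored with a module `E` over the larger ring can be
tested over the smaller ring. -/
lemma injective_rTensor_baseChange_iff {A T M N E : Type*} [CommRing A] [CommRing T] [Algebra A T]
    [AddCommGroup M] [AddCommGroup N] [AddCommGroup E] [Module A M] [Module A N]
    [Module A E] [Module T E] [IsScalarTower A T E] (φ : M →ₗ[A] N) :
    Function.Injective (LinearMap.rTensor (R := T) E (LinearMap.baseChange T φ)) ↔
      Function.Injective (LinearMap.rTensor E φ) := by
  let eM : (T ⊗[A] M) ⊗[T] E ≃+ M ⊗[A] E :=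
    (TensorProduct.comm T (T ⊗[A] M) E).toAddEquiv.trans
      ((AlgebraTensorModule.cancelBaseChange A T T E M).toAddEquiv.trans
        (TensorProduct.comm A E M).toAddEquiv)
  let eN : (T ⊗[A] N) ⊗[T] E ≃+ N ⊗[A] E :=
    (TensorProduct.comm T (T ⊗[A] N) E).toAddEquiv.trans
      ((AlgebraTensorModule.cancelBaseChange A T T E N).toAddEquiv.trans
        (TensorProduct.comm A E N).toAddEquiv)
  have key : ∀ z, eN (LinearMap.rTensor (R := T) E (LinearMap.baseChange T φ) z) =
      LinearMap.rTensor E φ (eM z) := by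
    intro z
    induction z with
    | zero => simp
    | add x y hx hy => simp only [map_add, hx, hy]
    | tmul y e =>
      induction y with
      | zero => simp
      | add x y hx hy => simp only [map_add, hx, hy, add_tmul]
      | tmul t m => simp [eM, eN]
  have hcomp : eN ∘ LinearMap.rTensor (R := T) E (LinearMap.baseChange T φ) =
      LinearMap.rTensor E φ ∘ eM := funext key
  rw [← eN.injective.of_comp_iff, hcomp, Function.Injective.of_comp_iff' _ eM.bijective]

/-- The domain of a pure map into a flat module is flat. -/
lemma flat_of_injective_rTensor {A M N : Type} [CommRing A]
    [AddCommGroup M] [AddCommGroup N] [Module A M] [Module A N] [Module.Flat A N]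
    (φ : M →ₗ[A] N)
    (h : ∀ (E : Type) [AddCommGroup E] [Module A E],
      Function.Injective (LinearMap.rTensor E φ)) : Module.Flat A M := by
  rw [Module.Flat.iff_lTensor_preserves_injective_linearMap]
  intro E E' _ _ _ _ f hf
  have hcomp : LinearMap.rTensor E' φ ∘ LinearMap.lTensor M f =
      LinearMap.lTensor N f ∘ LinearMap.rTensor E φ := by
    rw [← LinearMap.coe_comp, ← LinearMap.coe_comp, LinearMap.rTensor_comp_lTensor,
      LinearMap.lTensor_comp_rTensor]
  refine Function.Injective.of_comp (f := LinearMap.rTensor E' φ) ?_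
  rw [hcomp]
  exact (Module.Flat.lTensor_preserves_injective_linearMap f hf).comp (h E)

section Devissage

open scoped Pointwise

variable {A M N : Type*} [CommRing A] [AddCommGroup M] [AddCommGroup N] [Module A M] [Module A N]

lemma rTensor_lTensor_apply (φ : M →ₗ[A] N) {E E' : Type*} [AddCommGroup E] [Module A E]
    [AddCommGroup E'] [Module A E'] (f : E →ₗ[A] E') (x : M ⊗[A] E) :
    LinearMap.rTensor E' φ (LinearMap.lTensor M f x) =
      LinearMap.lTensor N f (LinearMap.rTensor E φ x) := by
  rw [← LinearMap.comp_apply, ← LinearMap.comp_apply, LinearMap.rTensor_comp_lTensor,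
      LinearMap.lTensor_comp_rTensor]

/-- The class of modules `E` such that `φ ⊗ E` is injective is closed under extensions when the
target of `φ` is flat. -/
lemma injective_rTensor_of_exact [Module.Flat A N] (φ : M →ₗ[A] N)
    {K E Q : Type*} [AddCommGroup K] [Module A K]
    [AddCommGroup E] [Module A E] [AddCommGroup Q] [Module A Q]
    {f : K →ₗ[A] E} {g : E →ₗ[A] Q} (hf : Function.Injective f) (hfg : Function.Exact f g)
    (hg : Function.Surjective g) (hK : Function.Injective (LinearMap.rTensor K φ))
    (hQ : Function.Injective (LinearMap.rTensor Q φ)) :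
    Function.Injective (LinearMap.rTensor E φ) := by
  rw [injective_iff_map_eq_zero]
  intro x hx
  have hx' : LinearMap.lTensor M g x = 0 := by
    apply hQ
    rw [rTensor_lTensor_apply, hx, map_zero, map_zero]
  obtain ⟨y, rfl⟩ := (lTensor_exact M hfg hg x).1 hx'
  rw [rTensor_lTensor_apply] at hx
  have hy : LinearMap.rTensor K φ y = 0 :=
    Module.Flat.lTensor_preserves_injective_linearMap f hf (by rw [hx, map_zero])
  rw [hK (hy.trans (map_zero _).symm), map_zero]

lemma lTensor_lsmul_apply_s11 (X K : Type*) [AddCommGroup X] [Module A X] [AddCommGroup K]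
    [Module A K] (a : A) (z : X ⊗[A] K) :
    LinearMap.lTensor X (LinearMap.lsmul A K a) z = a • z := by
  have : LinearMap.lTensor X (LinearMap.lsmul A K a) = a • LinearMap.id := by
    apply TensorProduct.ext'
    intro x k
    simp
  rw [this]
  rfl

/-- If `φ ⊗ (T ⊗ E)` is injective, the kernel of `φ ⊗ E` dies after base change to `T`. -/
lemma one_tmul_eq_zero_of_rTensor_eq_zero (φ : M →ₗ[A] N) (T : Type*) [CommRing T] [Algebra A T]
    {E : Type*} [AddCommGroup E] [Module A E]
    (hinj : Function.Injective (LinearMap.rTensor (T ⊗[A] E) φ))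
    (x : M ⊗[A] E) (hx : LinearMap.rTensor E φ x = 0) : (1 : T) ⊗ₜ[A] x = 0 := by
  have hcomm : ∀ z : M ⊗[A] E, TensorProduct.leftComm A M T E
      (LinearMap.lTensor M (TensorProduct.mk A T E 1) z) = (1 : T) ⊗ₜ[A] z := by
    intro z
    induction z with
    | zero => simp
    | tmul m e => simp
    | add y z hy hz => rw [map_add, map_add, hy, hz, tmul_add]
  have h0 : LinearMap.lTensor M (TensorProduct.mk A T E 1) x = 0 := by
    apply hinj
    rw [rTensor_lTensor_apply, hx, map_zero, map_zero]
  rw [← hcomm, h0, map_zero]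

lemma exists_eq_smul_of_lTensor_mkQ_eq_zero (X K : Type*) [AddCommGroup X] [Module A X]
    [AddCommGroup K]
    [Module A K] (a : A) (z : X ⊗[A] K)
    (hz : LinearMap.lTensor X (Submodule.mkQ (a • (⊤ : Submodule A K))) z = 0) :
    ∃ z', z = a • z' := by
  have hex : Function.Exact (LinearMap.lsmul A K a) (Submodule.mkQ (a • (⊤ : Submodule A K))) := by
    intro k
    rw [Submodule.mkQ_apply, Submodule.Quotient.mk_eq_zero, Submodule.mem_smul_pointwise_iff_exists]
    simp
  obtain ⟨z', rfl⟩ := (lTensor_exact X hex (Submodule.mkQ_surjective _) z).1 hz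
  exact ⟨z', lTensor_lsmul_apply_s11 X K a z'⟩

/-- If `0 → K → F → E → 0` is exact, `a` is regular on `E` and on `M ⊗ F`, and `φ ⊗ (K / aK)` is
injective for a map `φ : M → N` with `N` flat, then `a` is regular on `M ⊗ E`. -/
lemma isSMulRegular_tensor_of_exact [Module.Flat A N] (φ : M →ₗ[A] N)
    {K F E : Type*} [AddCommGroup K] [Module A K]
    [AddCommGroup F] [Module A F] [AddCommGroup E] [Module A E]
    {i : K →ₗ[A] F} {g : F →ₗ[A] E} (hi : Function.Injective i) (hig : Function.Exact i g)
    (hg : Function.Surjective g) (a : A) (hE : ∀ e : E, a • e = 0 → e = 0)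
    (hF : ∀ y : M ⊗[A] F, a • y = 0 → y = 0)
    (hK : Function.Injective (LinearMap.rTensor (QuotSMulTop a K) φ))
    (x : M ⊗[A] E) (hx : a • x = 0) : x = 0 := by
  obtain ⟨y, rfl⟩ := LinearMap.lTensor_surjective M hg x
  rw [← map_smul] at hx
  obtain ⟨z, hz⟩ := (lTensor_exact M hig hg _).1 hx
  have hinj : Function.Injective (QuotSMulTop.map a i) := by
    rw [injective_iff_map_eq_zero]
    intro k hk
    obtain ⟨k, rfl⟩ := Submodule.mkQ_surjective _ k
    rw [Submodule.mkQ_apply, QuotSMulTop.map_apply_mk, Submodule.Quotient.mk_eq_zero,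
      Submodule.mem_smul_pointwise_iff_exists] at hk
    obtain ⟨f, -, hf⟩ := hk
    have hgf : g f = 0 := by
      apply hE
      rw [← map_smul, hf]
      exact hig.apply_apply_eq_zero k
    obtain ⟨k', rfl⟩ := (hig f).1 hgf
    rw [Submodule.mkQ_apply, Submodule.Quotient.mk_eq_zero,
      Submodule.mem_smul_pointwise_iff_exists]
    exact ⟨k', trivial, hi (by rw [map_smul, hf])⟩
  have hz0 : LinearMap.lTensor M (Submodule.mkQ (a • (⊤ : Submodule A K))) z = 0 := by
    apply hK
    apply Module.Flat.lTensor_preserves_injective_linearMap (M := N) _ hinj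
    rw [← rTensor_lTensor_apply, ← LinearMap.lTensor_comp_apply]
    rw [QuotSMulTop.map_comp_mkQ, LinearMap.lTensor_comp_apply, hz, map_smul,
      ← LinearMap.smul_apply, ← LinearMap.lTensor_smul]
    have : a • Submodule.mkQ (a • (⊤ : Submodule A F)) = 0 := by
      ext f
      rw [LinearMap.smul_apply, ← map_smul, Submodule.mkQ_apply, LinearMap.zero_apply,
        Submodule.Quotient.mk_eq_zero]
      exact Submodule.smul_mem_pointwise_smul _ _ _ trivial
    rw [this]
    simp
  obtain ⟨z', rfl⟩ := exists_eq_smul_of_lTensor_mkQ_eq_zero M K a z hz0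
  rw [map_smul, ← sub_eq_zero, ← smul_sub] at hz
  rw [← sub_eq_zero.1 (hF _ hz)]
  exact (lTensor_exact M hig hg).apply_apply_eq_zero z'

end Devissage

/-- If `X` is killed by `p`, the kernel of `X → X ⊗ k(p)` consists of elements killed by
some `r ∉ p`. -/
lemma exists_smul_eq_zero_of_one_tmul_eq_zero {R A X : Type*} [CommRing R] [CommRing A]
    [Algebra R A] (p : Ideal R) [p.IsPrime] [AddCommGroup X] [Module A X]
    [Module (A ⧸ p.map (algebraMap R A)) X] [IsScalarTower A (A ⧸ p.map (algebraMap R A)) X]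
    (x : X) (hx : (1 : A ⊗[R] FractionRing (R ⧸ p)) ⊗ₜ[A] x = 0) :
    ∃ r ∉ p, algebraMap R A r • x = 0 := by
  let C := A ⧸ p.map (algebraMap R A)
  let S : Submonoid C := Algebra.algebraMapSubmonoid C p.primeCompl
  let B := Localization S
  let g : R ⧸ p →+* B := Ideal.Quotient.lift p (algebraMap R B) (by
    intro a ha
    rw [IsScalarTower.algebraMap_apply R C B, IsScalarTower.algebraMap_apply R A C,
      Ideal.Quotient.algebraMap_eq,
      Ideal.Quotient.eq_zero_iff_mem.2 (Ideal.mem_map_of_mem _ ha), map_zero])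
  have hg : ∀ y : nonZeroDivisors (R ⧸ p), IsUnit (g y) := by
    rintro ⟨y, hy⟩
    obtain ⟨r, rfl⟩ := Ideal.Quotient.mk_surjective y
    have hr : r ∉ p := fun h => nonZeroDivisors.ne_zero hy (Ideal.Quotient.eq_zero_iff_mem.2 h)
    have : algebraMap R B r = algebraMap C B (algebraMap R C r) :=
      IsScalarTower.algebraMap_apply R C B r
    simp only [g, Ideal.Quotient.lift_mk]
    rw [this]
    exact IsLocalization.map_units B (⟨_, Algebra.mem_algebraMapSubmonoid_of_mem ⟨r, hr⟩⟩ : S)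
  let k : FractionRing (R ⧸ p) →ₐ[R] B :=
    { IsLocalization.lift hg with
      commutes' := fun r => by
        simp only [RingHom.toMonoidHom_eq_coe, OneHom.toFun_eq_coe, MonoidHom.toOneHom_coe,
          MonoidHom.coe_coe]
        rw [IsScalarTower.algebraMap_apply R (R ⧸ p) (FractionRing (R ⧸ p)),
          IsLocalization.lift_eq]
        rfl }
  let f : A ⊗[R] FractionRing (R ⧸ p) →ₐ[A] B :=
    Algebra.TensorProduct.lift (Algebra.ofId A B) k (fun _ _ => Commute.all _ _)
  let L := LocalizedModule S X
  let ψ : B ⊗[A] X →ₗ[A] L := TensorProduct.lift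
    (LinearMap.mk₂ A (fun (b : B) (y : X) => b • (LocalizedModule.mk y (1 : S) : L))
      (fun b b' y => add_smul _ _ _) (fun c b y => smul_assoc _ _ _)
      (fun b y y' => by
        rw [← smul_add, LocalizedModule.mk_add_mk]; simp)
      (fun c b y => by
        have : (LocalizedModule.mk (c • y) (1 : S) : L) = c • LocalizedModule.mk y 1 := by
          rw [← algebraMap_smul C c y, ← algebraMap_smul C c (LocalizedModule.mk y 1 : L),
            LocalizedModule.smul'_mk]
        rw [this, smul_comm]))
  have h := congrArg (ψ ∘ LinearMap.rTensor X f.toLinearMap) hx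
  simp only [Function.comp_apply, LinearMap.rTensor_tmul, AlgHom.toLinearMap_apply, map_one,
    map_zero] at h
  have h' : (LocalizedModule.mk x (1 : S) : L) = 0 := by
    simpa [ψ] using h
  rw [← LocalizedModule.zero_mk (1 : S), LocalizedModule.mk_eq] at h'
  obtain ⟨⟨_, r, hr, rfl⟩, hu⟩ := h'
  refine ⟨r, hr, ?_⟩
  simp only [one_smul, smul_zero] at hu
  rw [← algebraMap_smul C (algebraMap R A r) x]
  exact hu

section Fibers

variable {R A : Type*} [CommRing R] [CommRing A] [Algebra R A]

/-- Torsionfreeness of `M/pM` over `R/p`, expressed through `M ⊗ A/pA`. -/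
lemma torsionfree_quotient_iff_tensor {M : Type*} [AddCommGroup M] [Module R M] [Module A M]
    [IsScalarTower R A M] (p : Ideal R) :
    (∀ (x : M ⧸ (p • ⊤ : Submodule R M)) (r : R), r ∉ p → r • x = 0 → x = 0) ↔
      ∀ (y : M ⊗[A] (A ⧸ p.map (algebraMap R A))) (r : R), r ∉ p →
        algebraMap R A r • y = 0 → y = 0 := by
  let e := TensorProduct.tensorQuotEquivQuotSMul M (p.map (algebraMap R A))
  have hmem : ∀ m : M, m ∈ (p.map (algebraMap R A) • ⊤ : Submodule A M) ↔
      m ∈ (p • ⊤ : Submodule R M) := by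
    intro m
    rw [← Submodule.restrictScalars_mem R, Submodule.restrictScalars_map_smul_eq,
      Submodule.restrictScalars_top]
  constructor
  · intro h y r hr hy
    apply e.injective
    obtain ⟨m, hm⟩ := Submodule.mkQ_surjective _ (e y)
    rw [← map_eq_zero_iff e e.injective, map_smul, ← hm, ← map_smul, Submodule.mkQ_apply,
      Submodule.Quotient.mk_eq_zero, hmem, algebraMap_smul] at hy
    rw [map_zero, ← hm, Submodule.mkQ_apply, Submodule.Quotient.mk_eq_zero, hmem,
      ← Submodule.Quotient.mk_eq_zero]
    exact h _ r hr (by rwa [← Submodule.Quotient.mk_smul, Submodule.Quotient.mk_eq_zero])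
  · intro h x r hr hx
    obtain ⟨m, rfl⟩ := Submodule.mkQ_surjective _ x
    rw [← map_smul, Submodule.mkQ_apply, Submodule.Quotient.mk_eq_zero] at hx
    rw [Submodule.mkQ_apply, Submodule.Quotient.mk_eq_zero, ← hmem,
      ← Submodule.Quotient.mk_eq_zero, ← map_eq_zero_iff e.symm e.symm.injective]
    apply h _ r hr
    rw [← map_smul, ← Submodule.Quotient.mk_smul, algebraMap_smul,
      map_eq_zero_iff e.symm e.symm.injective, Submodule.Quotient.mk_eq_zero, hmem]
    exact hx

/-- Torsionfreeness passes from `A/pA` to `M ⊗ A/pA` when `M` is flat over `A`. -/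
lemma torsionfree_tensor_of_flat {M : Type*} [AddCommGroup M] [Module A M] [Module.Flat A M]
    (p : Ideal R) (r : R)
    (h : ∀ x : A ⧸ p.map (algebraMap R A), r • x = 0 → x = 0)
    (y : M ⊗[A] (A ⧸ p.map (algebraMap R A))) (hy : algebraMap R A r • y = 0) : y = 0 := by
  have hinj : Function.Injective
      (LinearMap.lsmul A (A ⧸ p.map (algebraMap R A)) (algebraMap R A r)) := by
    rw [injective_iff_map_eq_zero]
    intro x hx
    exact h x (by rwa [LinearMap.lsmul_apply, algebraMap_smul] at hx)
  apply Module.Flat.lTensor_preserves_injective_linearMap (M := M) _ hinj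
  rw [map_zero, lTensor_lsmul_apply_s11, hy]

/-- If every element of `E` is killed by some `r ∉ p`, an element of `M ⊗ E` comes from
`M ⊗ E[r]` for a single `r ∉ p`. -/
lemma exists_lTensor_torsionBy {M E : Type*} [AddCommGroup M] [Module A M] [AddCommGroup E]
    [Module A E] (p : Ideal R) [p.IsPrime]
    (hE : ∀ e : E, ∃ r ∉ p, algebraMap R A r • e = 0) (y : M ⊗[A] E) :
    ∃ r ∉ p, ∃ z : M ⊗[A] Submodule.torsionBy A E (algebraMap R A r),
      LinearMap.lTensor M (Submodule.torsionBy A E (algebraMap R A r)).subtype z = y := by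
  have hle : ∀ r s : R, r ∣ s → Submodule.torsionBy A E (algebraMap R A r) ≤
      Submodule.torsionBy A E (algebraMap R A s) := fun r s h =>
    Submodule.torsionBy_le_torsionBy_of_dvd _ _ (map_dvd _ h)
  induction y with
  | zero => exact ⟨1, (Ideal.ne_top_iff_one p).1 (Ideal.IsPrime.ne_top ‹_›), 0, by simp⟩
  | tmul m e =>
    obtain ⟨r, hr, he⟩ := hE e
    exact ⟨r, hr, m ⊗ₜ ⟨e, (Submodule.mem_torsionBy_iff _ _).2 he⟩, by simp⟩
  | add y₁ y₂ h₁ h₂ =>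
    obtain ⟨r, hr, z, hz⟩ := h₁
    obtain ⟨s, hs, w, hw⟩ := h₂
    refine ⟨r * s, fun h => (Ideal.IsPrime.mem_or_mem ‹_› h).elim hr hs,
      LinearMap.lTensor M (Submodule.inclusion (hle r _ (dvd_mul_right r s))) z +
        LinearMap.lTensor M (Submodule.inclusion (hle s _ (dvd_mul_left s r))) w, ?_⟩
    rw [map_add, ← hz, ← hw, ← LinearMap.lTensor_comp_apply,
      ← LinearMap.lTensor_comp_apply, Submodule.subtype_comp_inclusion,
      Submodule.subtype_comp_inclusion]

/-- An `A`-module killed by an ideal `I` is a quotient of a free `A/I`-module. -/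
lemma exists_surjective_finsupp_quotient {E : Type*} [AddCommGroup E] [Module A E] (I : Ideal A)
    (hE : ∀ a ∈ I, ∀ e : E, a • e = 0) :
    ∃ g : (E →₀ (A ⧸ I)) →ₗ[A] E, Function.Surjective g := by
  refine ⟨Finsupp.lsum A fun e => Submodule.liftQ I (LinearMap.toSpanSingleton A E e)
    (fun a ha => hE a ha e), fun e => ⟨Finsupp.single e 1, ?_⟩⟩
  rw [Finsupp.lsum_single]
  exact one_smul A e

end Fibers

section Main

variable {R A M N : Type} [CommRing R] [CommRing A] [Algebra R A]
  [AddCommGroup M] [AddCommGroup N] [Module A M] [Module A N] [Module.Flat A N]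

/-- The torsionfree case: if `φ ⊗ E'` is injective for all `E'` killed by `p` and some `r ∉ p`,
then `φ ⊗ E` is injective for `E` killed by `p` and torsionfree over `R/p`. -/
lemma injective_rTensor_of_torsionfree (φ : M →ₗ[A] N) (p : Ideal R) [p.IsPrime]
    (hM : ∀ (y : M ⊗[A] (A ⧸ p.map (algebraMap R A))) (r : R), r ∉ p →
        algebraMap R A r • y = 0 → y = 0)
    (hφ : ∀ (E : Type) [AddCommGroup E] [Module (A ⊗[R] FractionRing (R ⧸ p)) E],
      Function.Injective (LinearMap.rTensor (R := A ⊗[R] FractionRing (R ⧸ p)) E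
        (LinearMap.baseChange (A ⊗[R] FractionRing (R ⧸ p)) φ)))
    (hind : ∀ r ∉ p, ∀ (E : Type) [AddCommGroup E] [Module A E],
      (∀ s ∈ p, ∀ e : E, algebraMap R A s • e = 0) → (∀ e : E, algebraMap R A r • e = 0) →
        Function.Injective (LinearMap.rTensor E φ))
    (E : Type) [AddCommGroup E] [Module A E]
    (hE : ∀ s ∈ p, ∀ e : E, algebraMap R A s • e = 0)
    (htf : ∀ r ∉ p, ∀ e : E, algebraMap R A r • e = 0 → e = 0) :
    Function.Injective (LinearMap.rTensor E φ) := by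
  have hEI : ∀ a ∈ p.map (algebraMap R A), ∀ e : E, a • e = 0 := by
    intro a ha e
    have hle : p.map (algebraMap R A) ≤ LinearMap.ker (LinearMap.toSpanSingleton A E e) :=
      Ideal.map_le_iff_le_comap.2 fun s hs => hE s hs e
    exact hle ha
  rw [injective_iff_map_eq_zero]
  intro x hx
  obtain ⟨r, hr, hrx⟩ : ∃ r ∉ p, algebraMap R A r • x = 0 := by
    have hX : Module.IsTorsionBySet A (M ⊗[A] E) (p.map (algebraMap R A)) := by
      rintro y ⟨a, ha⟩
      induction y with
      | zero => simp
      | tmul m e =>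
        change a • (m ⊗ₜ[A] e) = 0
        rw [← tmul_smul, hEI a ha, tmul_zero]
      | add y z hy hz => rw [smul_add, hy, hz, add_zero]
    let := hX.module
    have hinj := (injective_rTensor_baseChange_iff (T := A ⊗[R] FractionRing (R ⧸ p))
      (E := (A ⊗[R] FractionRing (R ⧸ p)) ⊗[A] E) φ).1
      (hφ ((A ⊗[R] FractionRing (R ⧸ p)) ⊗[A] E))
    exact exists_smul_eq_zero_of_one_tmul_eq_zero p x
      (one_tmul_eq_zero_of_rTensor_eq_zero φ _ hinj x hx)
  obtain ⟨g, hg⟩ := exists_surjective_finsupp_quotient (p.map (algebraMap R A)) hEI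
  refine isSMulRegular_tensor_of_exact φ (K := LinearMap.ker g)
    (F := E →₀ A ⧸ p.map (algebraMap R A)) (LinearMap.ker g).injective_subtype
    (LinearMap.exact_subtype_ker_map g) hg (algebraMap R A r) (htf r hr) ?_ ?_ x hrx
  · intro y hy
    classical
    let e := TensorProduct.finsuppRight A A M (A ⧸ p.map (algebraMap R A)) E
    rw [← map_eq_zero_iff e e.injective] at hy ⊢
    ext i
    refine hM _ r hr ?_
    rw [map_smul] at hy
    exact DFunLike.congr_fun hy i
  · refine hind r hr _ ?_ ?_
    · intro s hs e
      obtain ⟨k, rfl⟩ := Submodule.mkQ_surjective _ e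
      rw [← map_smul]
      have hk : algebraMap R A s • k = 0 := by
        refine Subtype.ext (Finsupp.ext fun i => ?_)
        obtain ⟨c, hc⟩ := Ideal.Quotient.mk_surjective ((k : E →₀ A ⧸ p.map (algebraMap R A)) i)
        change algebraMap R A s • (k : E →₀ A ⧸ p.map (algebraMap R A)) i = 0
        rw [← hc]
        exact Ideal.Quotient.eq_zero_iff_mem.2
          (Ideal.mul_mem_right _ _ (Ideal.mem_map_of_mem _ hs))
      rw [hk, map_zero]
    · intro e
      obtain ⟨k, rfl⟩ := Submodule.mkQ_surjective _ e
      rw [← map_smul, Submodule.mkQ_apply, Submodule.Quotient.mk_eq_zero]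
      exact Submodule.smul_mem_pointwise_smul _ _ _ trivial

/-- As `injective_rTensor_of_torsionfree`, without the torsionfreeness of `E`. -/
lemma injective_rTensor_of_killed_by_prime (φ : M →ₗ[A] N) (p : Ideal R) [p.IsPrime]
    (hM : ∀ (y : M ⊗[A] (A ⧸ p.map (algebraMap R A))) (r : R), r ∉ p →
        algebraMap R A r • y = 0 → y = 0)
    (hφ : ∀ (E : Type) [AddCommGroup E] [Module (A ⊗[R] FractionRing (R ⧸ p)) E],
      Function.Injective (LinearMap.rTensor (R := A ⊗[R] FractionRing (R ⧸ p)) E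
        (LinearMap.baseChange (A ⊗[R] FractionRing (R ⧸ p)) φ)))
    (hind : ∀ r ∉ p, ∀ (E : Type) [AddCommGroup E] [Module A E],
      (∀ s ∈ p, ∀ e : E, algebraMap R A s • e = 0) → (∀ e : E, algebraMap R A r • e = 0) →
        Function.Injective (LinearMap.rTensor E φ))
    (E : Type) [AddCommGroup E] [Module A E]
    (hE : ∀ s ∈ p, ∀ e : E, algebraMap R A s • e = 0) :
    Function.Injective (LinearMap.rTensor E φ) := by
  let Γ : Submodule A E :=
    { carrier := {e | ∃ r ∉ p, algebraMap R A r • e = 0}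
      zero_mem' := ⟨1, (Ideal.ne_top_iff_one p).1 (Ideal.IsPrime.ne_top ‹_›), smul_zero _⟩
      add_mem' := by
        rintro e e' ⟨r, hr, he⟩ ⟨s, hs, he'⟩
        refine ⟨r * s, fun h => (Ideal.IsPrime.mem_or_mem ‹_› h).elim hr hs, ?_⟩
        rw [smul_add, map_mul, mul_smul _ _ e', he', mul_comm, mul_smul, he]
        simp
      smul_mem' := by
        rintro a e ⟨r, hr, he⟩
        exact ⟨r, hr, by rw [smul_comm, he, smul_zero]⟩ }
  refine injective_rTensor_of_exact φ Γ.injective_subtype (LinearMap.exact_subtype_mkQ Γ)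
    Γ.mkQ_surjective ?_ ?_
  · rw [injective_iff_map_eq_zero]
    intro y hy
    obtain ⟨r, hr, z, rfl⟩ := exists_lTensor_torsionBy p
      (fun e : Γ => by
        obtain ⟨r, hr, he⟩ := e.2
        exact ⟨r, hr, Subtype.ext he⟩) y
    rw [rTensor_lTensor_apply] at hy
    have hz : LinearMap.rTensor _ φ z = 0 :=
      Module.Flat.lTensor_preserves_injective_linearMap _ (Submodule.injective_subtype _)
        (by rw [hy, map_zero])
    have hinj := hind r hr (Submodule.torsionBy A Γ (algebraMap R A r))
      (fun s hs e => Subtype.ext (Subtype.ext (hE s hs e))) (fun e => Subtype.ext e.2)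
    rw [hinj (hz.trans (map_zero _).symm), map_zero]
  · refine injective_rTensor_of_torsionfree φ p hM hφ hind _ ?_ ?_
    · intro s hs e
      obtain ⟨e, rfl⟩ := Γ.mkQ_surjective e
      rw [← map_smul, hE s hs, map_zero]
    · intro r hr e he
      obtain ⟨e, rfl⟩ := Γ.mkQ_surjective e
      rw [← map_smul, Submodule.mkQ_apply, Submodule.Quotient.mk_eq_zero] at he
      obtain ⟨s, hs, he⟩ := he
      rw [Submodule.mkQ_apply, Submodule.Quotient.mk_eq_zero]
      exact ⟨s * r, fun h => (Ideal.IsPrime.mem_or_mem ‹_› h).elim hs hr,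
        by rw [map_mul, mul_smul, he]⟩

/-- Dévissage: if `φ ⊗ E` is injective for all `E` killed by a prime `p`, provided it is so for
modules killed by `p` and a further element, then it is always injective. -/
lemma injective_rTensor_of_noetherian_induction [IsNoetherianRing R] (φ : M →ₗ[A] N)
    (h : ∀ p : Ideal R, p.IsPrime →
      (∀ r ∉ p, ∀ (E : Type) [AddCommGroup E] [Module A E],
        (∀ s ∈ p, ∀ e : E, algebraMap R A s • e = 0) → (∀ e : E, algebraMap R A r • e = 0) →
          Function.Injective (LinearMap.rTensor E φ)) →
      ∀ (E : Type) [AddCommGroup E] [Module A E],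
        (∀ s ∈ p, ∀ e : E, algebraMap R A s • e = 0) →
          Function.Injective (LinearMap.rTensor E φ))
    (I : Ideal R) : ∀ (E : Type) [AddCommGroup E] [Module A E],
      (∀ s ∈ I, ∀ e : E, algebraMap R A s • e = 0) →
        Function.Injective (LinearMap.rTensor E φ) := by
  induction I using (wellFounded_gt (α := Ideal R)).induction with
  | h I ih =>
  have hind : ∀ r ∉ I, ∀ (E : Type) [AddCommGroup E] [Module A E],
      (∀ s ∈ I, ∀ e : E, algebraMap R A s • e = 0) → (∀ e : E, algebraMap R A r • e = 0) →
        Function.Injective (LinearMap.rTensor E φ) := by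
    intro r hr E _ _ hI hrE
    refine ih (I ⊔ Ideal.span {r}) ?_ E ?_
    · exact left_lt_sup.2 fun hle => hr (hle (Ideal.mem_span_singleton_self r))
    · intro s hs e
      obtain ⟨a, ha, b, hb, rfl⟩ := Submodule.mem_sup.1 hs
      obtain ⟨c, rfl⟩ := Ideal.mem_span_singleton'.1 hb
      rw [map_add, add_smul, hI a ha, map_mul, mul_smul, hrE, smul_zero, add_zero]
  by_cases hI : I.IsPrime
  · exact h I hI hind
  intro E _ _ hE
  rcases Ideal.not_isPrime_iff.1 hI with rfl | ⟨a, ha, b, hb, hab⟩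
  · have : Subsingleton E := ⟨fun x y => by
      rw [← one_smul A x, ← one_smul A y, ← map_one (algebraMap R A), hE 1 trivial,
        hE 1 trivial]⟩
    exact Function.injective_of_subsingleton _
  · let K : Submodule A E := LinearMap.range (LinearMap.lsmul A E (algebraMap R A a))
    refine injective_rTensor_of_exact φ K.injective_subtype (LinearMap.exact_subtype_mkQ K)
      K.mkQ_surjective (hind b hb _ ?_ ?_) (hind a ha _ ?_ ?_)
    · exact fun s hs e => Subtype.ext (hE s hs e)
    · rintro ⟨_, e, rfl⟩
      apply Subtype.ext
      simp only [LinearMap.lsmul_apply, Submodule.coe_smul, ZeroMemClass.coe_zero]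
      rw [← mul_smul, ← map_mul, mul_comm, hE _ hab]
    · intro s hs e
      obtain ⟨e, rfl⟩ := K.mkQ_surjective e
      rw [← map_smul, hE s hs, map_zero]
    · intro e
      obtain ⟨e, rfl⟩ := K.mkQ_surjective e
      rw [← map_smul, Submodule.mkQ_apply, Submodule.Quotient.mk_eq_zero]
      exact ⟨e, rfl⟩

end Main


theorem pure_iff_fiber_criterion_torsionfree
    (R A : Type) [CommRing R] [IsNoetherianRing R] [CommRing A] [Algebra R A]
    (htf : ∀ (p : Ideal R), p.IsPrime →
      ∀ (x : A ⧸ Ideal.map (algebraMap R A) p) (r : R), r ∉ p → r • x = 0 → x = 0)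
    (M N : Type) [AddCommGroup M] [AddCommGroup N]
    [Module R M] [Module A M] [IsScalarTower R A M] [Module A N]
    (φ : M →ₗ[A] N) [Module.Flat A N] :
    (∀ (E : Type) [AddCommGroup E] [Module A E],
        Function.Injective (LinearMap.rTensor E φ)) ↔
      ∀ (p : Ideal R) [p.IsPrime],
        (∀ (x : M ⧸ (p • ⊤ : Submodule R M)) (r : R), r ∉ p → r • x = 0 → x = 0) ∧
        (∀ (E : Type) [AddCommGroup E] [Module (A ⊗[R] FractionRing (R ⧸ p)) E],
          Function.Injective (LinearMap.rTensor (R := A ⊗[R] FractionRing (R ⧸ p)) E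
            (LinearMap.baseChange (A ⊗[R] FractionRing (R ⧸ p)) φ))) := by
  constructor
  · intro h p _
    have := flat_of_injective_rTensor φ h
    refine ⟨(torsionfree_quotient_iff_tensor p).2 fun y r hr hy =>
      torsionfree_tensor_of_flat p r (fun x => htf p ‹_› x r hr) y hy, ?_⟩
    intro E _ _
    let : Module A E := Module.compHom E (algebraMap A (A ⊗[R] FractionRing (R ⧸ p)))
    have : IsScalarTower A (A ⊗[R] FractionRing (R ⧸ p)) E :=
      ⟨fun a t e => (congrArg (· • e) (Algebra.smul_def a t)).trans (mul_smul _ _ _)⟩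
    exact (injective_rTensor_baseChange_iff φ).2 (h E)
  · intro h E _ _
    refine injective_rTensor_of_noetherian_induction φ (R := R) ?_ ⊥ E ?_
    · intro p _ hind E _ _ hE
      exact injective_rTensor_of_killed_by_prime φ p
        ((torsionfree_quotient_iff_tensor p).1 (h p).1) (h p).2 hind E hE
    · intro s hs e
      rw [(Submodule.mem_bot R).1 hs, map_zero, zero_smul]
end

section
/- Let R be a commutative noetherian ring and φ : M → N an R-linear map of R-modules, where N is a flat R-module. Then φ is pure if and only if for every prime ideal p of R, the (R/p)-module M/pM is torsionfree and the map φ ⊗_R k(p) : M ⊗_R k(p) → N ⊗_R k(p) is injective. -/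
set_option synthInstance.maxHeartbeats 1000000

open TensorProduct in
/-- If multiplication by each `r ∉ p` is injective on `M ⊗ R ⧸ p`, then `M ⊗ R ⧸ p` embeds into
its localization `M ⊗ k(p)`. -/
theorem lTensor_fractionRing_quotient_injective {R M : Type*} [CommRing R] [AddCommGroup M]
    [Module R M] (p : Ideal R) [p.IsPrime]
    (h : ∀ (x : M ⊗[R] (R ⧸ p)) (r : R), r ∉ p → r • x = 0 → x = 0) :
    Function.Injective
      (LinearMap.lTensor M
        (IsScalarTower.toAlgHom R (R ⧸ p) (FractionRing (R ⧸ p))).toLinearMap) := by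
  set f := (IsScalarTower.toAlgHom R (R ⧸ p) (FractionRing (R ⧸ p))).toLinearMap
  have hne {r : R} (hr : r ∉ p) : algebraMap R (R ⧸ p) r ≠ 0 := by
    rwa [Ne, Ideal.Quotient.algebraMap_eq, Ideal.Quotient.eq_zero_iff_mem]
  have hfinj : Function.Injective f := IsFractionRing.injective (R ⧸ p) (FractionRing (R ⧸ p))
  have : IsLocalizedModule p.primeCompl f := by
    refine ⟨fun r ↦ ?_, fun y ↦ ?_, fun {x y} hxy ↦ ⟨1, by rw [hfinj hxy]⟩⟩
    · rw [← (Algebra.lmul R (FractionRing (R ⧸ p))).commutes]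
      refine (IsUnit.mk0 (algebraMap R (FractionRing (R ⧸ p)) r) ?_).map
        (Algebra.lmul R (FractionRing (R ⧸ p)))
      rw [IsScalarTower.algebraMap_apply R (R ⧸ p)]
      simpa using hne r.2
    · obtain ⟨⟨a, s⟩, hs⟩ := IsLocalization.surj (nonZeroDivisors (R ⧸ p)) y
      obtain ⟨r, hr⟩ := Ideal.Quotient.mk_surjective s.1
      have hrp : r ∉ p := fun hmem ↦ nonZeroDivisors.ne_zero s.2
        (by rw [← hr]; exact Ideal.Quotient.eq_zero_iff_mem.mpr hmem)
      refine ⟨(a, ⟨r, hrp⟩), ?_⟩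
      change r • y = algebraMap _ _ a
      rw [← hs, ← hr, mul_comm, ← Algebra.smul_def]
      exact (algebraMap_smul (R ⧸ p) r y).symm
  have hloc : IsLocalizedModule p.primeCompl (LinearMap.rTensor M f) :=
    IsLocalizedModule.rTensor (A := R) (R := R) (N := M) p.primeCompl f
  rw [LinearMap.lTensor_inj_iff_rTensor_inj, injective_iff_map_eq_zero]
  intro x hx
  obtain ⟨s, hs⟩ := (IsLocalizedModule.eq_zero_iff p.primeCompl (LinearMap.rTensor M f)).mp hx
  apply (TensorProduct.comm R (R ⧸ p) M).injective
  rw [map_zero]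
  refine h _ s s.2 ?_
  rw [← map_smul]
  exact (congrArg _ hs).trans (map_zero _)

/-- For a flat target, injectivity of `φ ⊗ id` is stable under extensions. -/
theorem LinearMap.rTensor_injective_of_exact {R M N E₁ E₂ E₃ : Type*} [CommRing R]
    [AddCommGroup M] [AddCommGroup N] [AddCommGroup E₁] [AddCommGroup E₂] [AddCommGroup E₃]
    [Module R M] [Module R N] [Module R E₁] [Module R E₂] [Module R E₃] [Module.Flat R N]
    (φ : M →ₗ[R] N) {f : E₁ →ₗ[R] E₂} {g : E₂ →ₗ[R] E₃} (hf : Function.Injective f)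
    (hg : Function.Surjective g) (hfg : Function.Exact f g)
    (h₁ : Function.Injective (φ.rTensor E₁)) (h₃ : Function.Injective (φ.rTensor E₃)) :
    Function.Injective (φ.rTensor E₂) := by
  rw [injective_iff_map_eq_zero]
  intro x hx
  have hgx : g.lTensor M x = 0 := by
    apply h₃
    rw [map_zero, ← LinearMap.comp_apply, LinearMap.rTensor_comp_lTensor,
      ← LinearMap.lTensor_comp_rTensor, LinearMap.comp_apply, hx, map_zero]
  obtain ⟨y, rfl⟩ := (lTensor_exact M hfg hg x).mp hgx
  have hy : y = 0 := by
    apply h₁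
    apply Module.Flat.lTensor_preserves_injective_linearMap (M := N) f hf
    rw [map_zero, map_zero, ← LinearMap.comp_apply, LinearMap.lTensor_comp_rTensor,
      ← LinearMap.rTensor_comp_lTensor, LinearMap.comp_apply, hx]
  rw [hy, map_zero]

/-- For a flat target, injectivity of `φ ⊗ id` can be tested on finitely generated submodules. -/
theorem LinearMap.rTensor_injective_of_forall_finite {R M N E : Type*} [CommRing R]
    [AddCommGroup M] [AddCommGroup N] [AddCommGroup E] [Module R M] [Module R N] [Module R E]
    [Module.Flat R N] (φ : M →ₗ[R] N)
    (h : ∀ E' : Submodule R E, Module.Finite R E' → Function.Injective (φ.rTensor E')) :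
    Function.Injective (φ.rTensor E) := by
  rw [injective_iff_map_eq_zero]
  intro x hx
  obtain ⟨E', hE', hmem⟩ := TensorProduct.exists_finite_submodule_right_of_setFinite
    {x} (Set.finite_singleton x)
  obtain ⟨y, rfl⟩ := hmem rfl
  have hy : y = 0 := by
    apply h E' hE'
    apply Module.Flat.lTensor_preserves_injective_linearMap (M := N) E'.subtype
      E'.injective_subtype
    rw [map_zero, map_zero, ← LinearMap.comp_apply, LinearMap.lTensor_comp_rTensor,
      ← LinearMap.rTensor_comp_lTensor, LinearMap.comp_apply, hx]
  rw [hy, map_zero]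

/-- Injectivity of `φ ⊗ id` only depends on the isomorphism class of the module. -/
theorem LinearMap.rTensor_injective_of_linearEquiv {R M N E E' : Type*} [CommRing R]
    [AddCommGroup M] [AddCommGroup N] [AddCommGroup E] [AddCommGroup E'] [Module R M] [Module R N]
    [Module R E] [Module R E'] (φ : M →ₗ[R] N) (e : E ≃ₗ[R] E')
    (h : Function.Injective (φ.rTensor E')) : Function.Injective (φ.rTensor E) := by
  have hcomp : Function.Injective (φ.rTensor E' ∘ₗ (e.lTensor M).toLinearMap) :=
    h.comp (e.lTensor M).injective
  rw [LinearEquiv.coe_lTensor, LinearMap.rTensor_comp_lTensor,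
    ← LinearMap.lTensor_comp_rTensor] at hcomp
  exact Function.Injective.of_comp hcomp

theorem pure_iff_fiber_criterion_one_base
    (R M N : Type) [CommRing R] [IsNoetherianRing R]
    [AddCommGroup M] [AddCommGroup N] [Module R M] [Module R N]
    (φ : M →ₗ[R] N) [Module.Flat R N] :
    (∀ (E : Type) [AddCommGroup E] [Module R E],
        Function.Injective (LinearMap.rTensor E φ)) ↔
      ∀ (p : Ideal R) [p.IsPrime],
        (∀ (x : M ⧸ (p • ⊤ : Submodule R M)) (r : R), r ∉ p → r • x = 0 → x = 0) ∧
        Function.Injective (LinearMap.rTensor (FractionRing (R ⧸ p)) φ) := by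
  constructor
  · refine fun h p _ ↦ ⟨fun x r hr hx ↦ ?_, h _⟩
    have hreg : IsSMulRegular (R ⧸ p) r := by
      rw [isSMulRegular_iff_right_eq_zero_of_smul]
      intro y hy
      rw [Algebra.smul_def, mul_eq_zero, Ideal.Quotient.algebraMap_eq,
        Ideal.Quotient.eq_zero_iff_mem] at hy
      exact hy.resolve_left hr
    have hregN := IsSMulRegular.lTensor N hreg
    let e := TensorProduct.tensorQuotEquivQuotSMul M p
    apply e.symm.injective
    apply h (R ⧸ p)
    rw [map_zero, map_zero]
    apply hregN.right_eq_zero_of_smul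
    rw [← map_smul, ← map_smul, hx, map_zero, map_zero]
  · intro h E _ _
    refine LinearMap.rTensor_injective_of_forall_finite φ fun E' hE' ↦ ?_
    refine IsNoetherianRing.induction_on_isQuotientEquivQuotientPrime R hE'
      (motive := fun E _ _ _ ↦ Function.Injective (φ.rTensor E)) ?_ ?_ ?_
    · intro E _ _ _ _
      exact Function.injective_of_subsingleton _
    · intro E _ _ _ p e
      refine LinearMap.rTensor_injective_of_linearEquiv φ e ?_
      obtain ⟨htf, hinj⟩ := h p.1
      have hcomp := hinj.comp (lTensor_fractionRing_quotient_injective (M := M) p.1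
        fun x r hr hx ↦ by
          apply (TensorProduct.tensorQuotEquivQuotSMul M p.1).injective
          rw [map_zero]
          exact htf _ r hr (by rw [← map_smul, hx, map_zero]))
      rw [← LinearMap.coe_comp, LinearMap.rTensor_comp_lTensor,
        ← LinearMap.lTensor_comp_rTensor] at hcomp
      exact Function.Injective.of_comp hcomp
    · intro E₁ _ _ _ E₂ _ _ _ E₃ _ _ _ f g hf hg hfg h₁ h₃
      exact LinearMap.rTensor_injective_of_exact φ hf hg hfg h₁ h₃
end

section
/- There exist a commutative noetherian ring R, a ring homomorphism R → A, and an A-module M such that: (1) M is flat as an R-module; (2) Tor_1^A(A/pA, M) = 0 for every prime ideal p of R; (3) M ⊗_R k(p) is a flat (A ⊗_R k(p))-module for every prime ideal p of R; and yet (4) M is NOT a flat A-module. (One such example: R = k⟦t⟧ for a field k, S = R[x_1, x_2, …] the polynomial ring in countably many variables, H = (t^i x_i − t^{i+1} x_{i+1}, x_i − t^2 x_{i+2} : i ≥ 1), I = (x_i − t x_{i+1} : i ≥ 1), A = S/H and M = S/I.) -/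
/-!
Question 6.1 / Example 6.2: there exist a commutative noetherian ring `R`, a ring
homomorphism `R → A` and an `A`-module `M` such that
(1) `M` is flat over `R`;
(2) `Tor₁^A(A/pA, M) = 0` for every prime `p` of `R`;
(3) the fiber `M ⊗_R k(p)` is a flat `A ⊗_R k(p)`-module for every prime `p` of `R`
(realized as the base change `(A ⊗[R] k(p)) ⊗[A] M`, with `k(p) = Frac(R ⧸ p)`);
and yet (4) `M` is NOT flat over `A`.
-/

set_option synthInstance.maxHeartbeats 1000000

open TensorProduct CategoryTheory

/-- The data of a counterexample to Question 6.1 of the paper. -/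
structure FlatFiberCounterexample where
  R : Type
  A : Type
  M : Type
  [instCommRingR : CommRing R]
  [instNoetherian : IsNoetherianRing R]
  [instCommRingA : CommRing A]
  [instAlgebra : Algebra R A]
  [instAddCommGroup : AddCommGroup M]
  [instModuleR : Module R M]
  [instModuleA : Module A M]
  [instTower : IsScalarTower R A M]
  flat_over_R : Module.Flat R M
  tor_vanishing : ∀ (p : Ideal R), p.IsPrime →
    Subsingleton (((Tor (ModuleCat A) 1).obj
      (ModuleCat.of A (A ⧸ Ideal.map (algebraMap R A) p))).obj (ModuleCat.of A M))
  fiber_flat : ∀ (p : Ideal R) [p.IsPrime],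
    Module.Flat (A ⊗[R] FractionRing (R ⧸ p)) ((A ⊗[R] FractionRing (R ⧸ p)) ⊗[A] M)
  not_flat_over_A : ¬ Module.Flat A M

open MonoidalCategory in
/-- The module `Tor₁(N, M)` vanishes as soon as, for every exact sequence `P₂ → P₁ → P₀ → M`,
the sequence `N ⊗ P₂ → N ⊗ P₁ → N ⊗ P₀` is exact. -/
theorem subsingleton_tor_one_of_exact {A : Type} [CommRing A] (N M : ModuleCat.{0} A)
    (H : ∀ {P₂ P₁ P₀ : Type} [AddCommGroup P₂] [AddCommGroup P₁] [AddCommGroup P₀]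
      [Module A P₂] [Module A P₁] [Module A P₀] (f : P₂ →ₗ[A] P₁) (g : P₁ →ₗ[A] P₀)
      (e : P₀ →ₗ[A] M), Function.Exact f g → Function.Exact g e →
      Function.Exact (f.lTensor N) (g.lTensor N)) :
    Subsingleton (((Tor (ModuleCat A) 1).obj N).obj M) := by
  let P := projectiveResolution M
  let F := (tensoringLeft (ModuleCat.{0} A)).obj N
  rw [← ModuleCat.isZero_iff_subsingleton]
  refine Limits.IsZero.of_iso ?_ (P.isoLeftDerivedObj F 1)
  refine (HomologicalComplex.exactAt_iff_isZero_homology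
    ((F.mapHomologicalComplex _).obj P.complex) 1).mp ?_
  rw [HomologicalComplex.exactAt_iff' _ 2 1 0 (by simp) (by simp),
    ShortComplex.ShortExact.moduleCat_exact_iff_function_exact]
  exact H (P.complex.d 2 1).hom (P.complex.d 1 0).hom (P.π.f 0).hom
    ((ShortComplex.ShortExact.moduleCat_exact_iff_function_exact _).mp (P.exact_succ 0))
    ((ShortComplex.ShortExact.moduleCat_exact_iff_function_exact _).mp P.exact₀)

/-- If `a = 0` or `a` is a nonzerodivisor on `M`, then tensoring with `A ⧸ aA` preserves exactness
in the middle of partial resolutions of `M`. -/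
theorem exact_lTensor_quotient_span_singleton {A M P₂ P₁ P₀ : Type*} [CommRing A]
    [AddCommGroup M] [AddCommGroup P₂] [AddCommGroup P₁] [AddCommGroup P₀]
    [Module A M] [Module A P₂] [Module A P₁] [Module A P₀]
    {a : A} (ha : ∀ m : M, a • m = 0 → a = 0 ∨ m = 0)
    {f : P₂ →ₗ[A] P₁} {g : P₁ →ₗ[A] P₀} {e : P₀ →ₗ[A] M}
    (hfg : Function.Exact f g) (hge : Function.Exact g e) :
    Function.Exact (f.lTensor (A ⧸ Ideal.span {a})) (g.lTensor (A ⧸ Ideal.span {a})) := by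
  have hspan : ∀ p : P₁, (1 : A ⧸ Ideal.span {a}) ⊗ₜ[A] (a • p) = 0 := fun p ↦ by
    have h1 : a • (1 : A ⧸ Ideal.span {a}) = 0 := by
      rw [Algebra.smul_def, mul_one]
      exact Ideal.Quotient.eq_zero_iff_mem.mpr (Ideal.mem_span_singleton_self a)
    rw [← TensorProduct.smul_tmul, h1, TensorProduct.zero_tmul]
  intro x
  constructor
  · obtain ⟨p, rfl⟩ : ∃ p : P₁, 1 ⊗ₜ[A] p = x := by
      obtain ⟨p, hp⟩ := Submodule.Quotient.mk_surjective _
        (TensorProduct.quotTensorEquivQuotSMul P₁ (Ideal.span {a}) x)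
      refine ⟨p, (TensorProduct.quotTensorEquivQuotSMul P₁ (Ideal.span {a})).injective ?_⟩
      rw [TensorProduct.quotTensorEquivQuotSMul_mk_one_tmul, hp]
    intro hx
    rw [LinearMap.lTensor_tmul,
      ← (TensorProduct.quotTensorEquivQuotSMul P₀ (Ideal.span {a})).map_eq_zero_iff,
      TensorProduct.quotTensorEquivQuotSMul_mk_one_tmul, Submodule.Quotient.mk_eq_zero,
      Submodule.ideal_span_singleton_smul, Submodule.mem_smul_pointwise_iff_exists] at hx
    obtain ⟨z, -, hz⟩ := hx
    obtain ⟨w, hw⟩ : ∃ w, a • g w = g p := by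
      rcases ha (e z) (by rw [← map_smul, hz, hge.apply_apply_eq_zero]) with h0 | h0
      · exact ⟨0, by rw [← hz, h0, zero_smul, zero_smul]⟩
      · obtain ⟨w, rfl⟩ := (hge z).mp h0
        exact ⟨w, hz⟩
    obtain ⟨u, hu⟩ := (hfg (p - a • w)).mp (by rw [map_sub, map_smul, hw, sub_self])
    refine ⟨1 ⊗ₜ u, ?_⟩
    rw [LinearMap.lTensor_tmul, hu, TensorProduct.tmul_sub, hspan, sub_zero]
  · rintro ⟨y, rfl⟩
    rw [← LinearMap.comp_apply, ← LinearMap.lTensor_comp, hfg.linearMap_comp_eq_zero,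
      LinearMap.lTensor_zero, LinearMap.zero_apply]

theorem IsField.flat {B : Type*} [CommRing B] (hB : IsField B) (N : Type*) [AddCommMonoid N]
    [Module B N] : Module.Flat B N := by
  let := Module.addCommMonoidToAddCommGroup B (M := N)
  let := hB.toField
  infer_instance

section TrivSqZeroExt

variable (R J : Type) [CommRing R] [AddCommGroup J] [Module R J] [Module Rᵐᵒᵖ J]
  [IsCentralScalar R J]

/-- The ring `R` as a module over the trivial square-zero extension of `R` by `J`. -/
noncomputable local instance baseModule : Module (TrivSqZeroExt R J) R :=
  Module.compHom R (TrivSqZeroExt.fstHom R R J).toRingHom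

theorem TrivSqZeroExt.base_smul_def (a : TrivSqZeroExt R J) (n : R) : a • n = a.fst * n := rfl

theorem not_flat_base_of_nontrivial [Nontrivial J] : ¬ Module.Flat (TrivSqZeroExt R J) R := by
  intro hflat
  obtain ⟨x, hx⟩ := exists_ne (0 : J)
  obtain ⟨k, a, y, hy, ha⟩ := Module.Flat.isTrivialRelation_of_sum_smul_eq_zero
    (f := fun _ : Unit ↦ (TrivSqZeroExt.inr x : TrivSqZeroExt R J)) (x := fun _ ↦ (1 : R))
    (by simp [TrivSqZeroExt.base_smul_def])
  have hax : ∀ j, (a () j).fst • x = 0 := fun j ↦ by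
    simpa using congrArg TrivSqZeroExt.snd (ha j)
  apply hx
  have h1 : (1 : R) = ∑ j, a () j • y j := hy ()
  rw [← one_smul R x, h1, Finset.sum_smul]
  refine Finset.sum_eq_zero fun j _ ↦ ?_
  rw [TrivSqZeroExt.base_smul_def, mul_comm, mul_smul, hax, smul_zero]

theorem subsingleton_tor_one_base [IsDomain R] [IsPrincipalIdealRing R] (p : Ideal R) :
    Subsingleton (((Tor (ModuleCat (TrivSqZeroExt R J)) 1).obj
      (ModuleCat.of _ (TrivSqZeroExt R J ⧸
        Ideal.map (algebraMap R (TrivSqZeroExt R J)) p))).obj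
      (ModuleCat.of (TrivSqZeroExt R J) R)) := by
  obtain ⟨n, rfl⟩ := (IsPrincipalIdealRing.principal p).principal
  rw [Ideal.submodule_span_eq, Ideal.map_span, Set.image_singleton]
  refine subsingleton_tor_one_of_exact _ _ fun f g e hfg hge ↦
    exact_lTensor_quotient_span_singleton (fun m hm ↦ ?_) hfg hge
  have hm' : n * m = 0 := hm
  rcases mul_eq_zero.mp hm' with h | h
  · exact Or.inl (by rw [h, map_zero])
  · exact Or.inr h

/-- If `J` is torsion and divisible, then all fibers of the trivial square-zero extension of `R`
by `J` are fields. -/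
theorem isField_tensorProduct_of_torsion_of_divisible
    (htors : ∀ j : J, ∃ n : R, n ≠ 0 ∧ n • j = 0)
    (hdiv : ∀ (j : J) (n : R), n ≠ 0 → ∃ j', n • j' = j) (k : Type)
    [Field k] [Algebra R k] :
    IsField (TrivSqZeroExt R J ⊗[R] k) := by
  have hJ : ∀ (j : J) (x : k), (TrivSqZeroExt.inr j : TrivSqZeroExt R J) ⊗ₜ[R] x = 0 := by
    intro j x
    obtain ⟨n, hn, hnj⟩ := htors j
    by_cases hk : algebraMap R k n = 0
    · obtain ⟨j', rfl⟩ := hdiv j n hn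
      rw [TrivSqZeroExt.inr_smul, TensorProduct.smul_tmul, Algebra.smul_def, hk, zero_mul,
        TensorProduct.tmul_zero]
    · have hx : x = n • ((algebraMap R k n)⁻¹ * x) := by
        rw [Algebra.smul_def, mul_inv_cancel_left₀ hk]
      rw [hx, ← TensorProduct.smul_tmul, ← TrivSqZeroExt.inr_smul, hnj, TrivSqZeroExt.inr_zero,
        TensorProduct.zero_tmul]
  let i : k →+* TrivSqZeroExt R J ⊗[R] k :=
    (Algebra.TensorProduct.includeRight : k →ₐ[R] TrivSqZeroExt R J ⊗[R] k).toRingHom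
  let r : TrivSqZeroExt R J ⊗[R] k →+* k :=
    (Algebra.TensorProduct.lift ((Algebra.ofId R k).comp (TrivSqZeroExt.fstHom R R J))
      (AlgHom.id R k) fun _ _ ↦ Commute.all _ _).toRingHom
  have hsurj : Function.Surjective i := by
    intro y
    induction y with
    | zero => exact ⟨0, map_zero i⟩
    | add a b ha hb =>
      obtain ⟨a, rfl⟩ := ha
      obtain ⟨b, rfl⟩ := hb
      exact ⟨a + b, map_add i a b⟩
    | tmul a x =>
      refine ⟨a.fst • x, ?_⟩
      change (1 : TrivSqZeroExt R J) ⊗ₜ[R] (a.fst • x) = a ⊗ₜ x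
      conv_rhs => rw [← TrivSqZeroExt.inl_fst_add_inr_snd_eq a, TensorProduct.add_tmul, hJ,
        add_zero]
      rw [← TensorProduct.smul_tmul]
      congr 1
      ext <;> simp
  have : Nontrivial (TrivSqZeroExt R J ⊗[R] k) := r.domain_nontrivial
  exact (RingEquiv.ofBijective i ⟨i.injective, hsurj⟩).symm.toMulEquiv.isField
    (Field.toIsField k)

theorem flat_tensorProduct_of_torsion_of_divisible
    (htors : ∀ j : J, ∃ n : R, n ≠ 0 ∧ n • j = 0)
    (hdiv : ∀ (j : J) (n : R), n ≠ 0 → ∃ j', n • j' = j) (k : Type) [Field k] [Algebra R k]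
    (N : Type) [AddCommMonoid N] [Module (TrivSqZeroExt R J ⊗[R] k) N] :
    Module.Flat (TrivSqZeroExt R J ⊗[R] k) N :=
  IsField.flat (isField_tensorProduct_of_torsion_of_divisible R J htors hdiv k) N

/-- The counterexample given by a principal ideal domain `R` and a nonzero torsion divisible
`R`-module `J`: the ring is the trivial square-zero extension of `R` by `J`, the module is `R`. -/
noncomputable def flatFiberCounterexample [IsDomain R] [IsPrincipalIdealRing R] [Nontrivial J]
    (htors : ∀ j : J, ∃ n : R, n ≠ 0 ∧ n • j = 0)
    (hdiv : ∀ (j : J) (n : R), n ≠ 0 → ∃ j', n • j' = j) : FlatFiberCounterexample where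
  R := R
  A := TrivSqZeroExt R J
  M := R
  instTower := ⟨fun n a m ↦ by
    simp only [TrivSqZeroExt.base_smul_def, TrivSqZeroExt.fst_smul, smul_eq_mul, mul_assoc]⟩
  flat_over_R := inferInstance
  tor_vanishing := fun p _ ↦ subsingleton_tor_one_base R J p
  fiber_flat := fun p _ ↦
    flat_tensorProduct_of_torsion_of_divisible R J htors hdiv (FractionRing (R ⧸ p)) _
  not_flat_over_A := not_flat_base_of_nontrivial R J

end TrivSqZeroExt

/-- The torsion divisible group `ℚ / ℤ`. -/
abbrev RatModInt : Type := ℚ ⧸ (Int.castAddHom ℚ).range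

noncomputable instance : Module ℤᵐᵒᵖ RatModInt :=
  Module.compHom RatModInt (RingEquiv.toOpposite ℤ).symm.toRingHom

instance : IsCentralScalar ℤ RatModInt := ⟨fun _ _ ↦ rfl⟩

theorem RatModInt.exists_ne_zero_zsmul_eq_zero (j : RatModInt) : ∃ n : ℤ, n ≠ 0 ∧ n • j = 0 := by
  obtain ⟨q, rfl⟩ := QuotientAddGroup.mk_surjective j
  refine ⟨q.den, mod_cast q.den_ne_zero, ?_⟩
  rw [← QuotientAddGroup.mk_zsmul, QuotientAddGroup.eq_zero_iff]
  exact ⟨q.num, by simp [Rat.den_mul_eq_num]⟩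

theorem RatModInt.exists_zsmul_eq (j : RatModInt) (n : ℤ) (hn : n ≠ 0) : ∃ j', n • j' = j := by
  obtain ⟨q, rfl⟩ := QuotientAddGroup.mk_surjective j
  refine ⟨((q / n : ℚ) : RatModInt), ?_⟩
  rw [← QuotientAddGroup.mk_zsmul, zsmul_eq_mul, mul_div_cancel₀ _ (by exact_mod_cast hn)]

instance : Nontrivial RatModInt := by
  refine ⟨((1 / 2 : ℚ) : RatModInt), 0, fun h ↦ ?_⟩
  obtain ⟨n, hn⟩ := (QuotientAddGroup.eq_zero_iff _).mp h
  have h2 : (2 * n : ℚ) = 1 := by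
    have : (n : ℚ) = 1 / 2 := hn
    rw [this]; norm_num
  have : 2 * n = 1 := by exact_mod_cast h2
  lia

theorem exists_flat_fiber_counterexample : Nonempty FlatFiberCounterexample :=
  ⟨flatFiberCounterexample ℤ RatModInt RatModInt.exists_ne_zero_zsmul_eq_zero
    RatModInt.exists_zsmul_eq⟩
end

section
/- Let k be a field, R = k⟦t⟧ the power series ring in one variable, and S = R[x_1, x_2, …] the polynomial ring over R in countably infinitely many variables. Let I be the ideal of S generated by the elements x_i − t·x_{i+1} for all i ≥ 1. Then the ideal quotient (I : t) equals I; that is, for every f ∈ S, if t·f ∈ I then f ∈ I. -/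
namespace MvPolynomial

variable {R : Type*} [CommRing R]

/-- The ideal of `R[x₀, x₁, …]` generated by the elements `xᵢ - t * xᵢ₊₁`. -/
noncomputable def divisionIdeal (t : R) : Ideal (MvPolynomial ℕ R) :=
  Ideal.span (Set.range fun i : ℕ => X i - C t * X (i + 1))

theorem divisionIdeal_mk_X (t : R) (i d : ℕ) :
    Ideal.Quotient.mkₐ R (divisionIdeal t) (X i) =
      t ^ d • Ideal.Quotient.mkₐ R (divisionIdeal t) (X (i + d)) := by
  induction d with
  | zero => simp
  | succ d ih =>
    have h : Ideal.Quotient.mkₐ R (divisionIdeal t) (X (i + d)) =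
        t • Ideal.Quotient.mkₐ R (divisionIdeal t) (X (i + d + 1)) := by
      rw [← map_smul, smul_eq_C_mul]
      exact Ideal.Quotient.eq.2 (Ideal.subset_span ⟨i + d, rfl⟩)
    rw [ih, h, smul_smul, ← pow_succ, add_assoc]

/-- Modulo `divisionIdeal t`, every polynomial is a polynomial in `xₙ` for large `n`. -/
theorem eventually_mk_mem_adjoin_X (t : R) (f : MvPolynomial ℕ R) :
    ∀ᶠ n in Filter.atTop, Ideal.Quotient.mkₐ R (divisionIdeal t) f ∈
      Algebra.adjoin R {Ideal.Quotient.mkₐ R (divisionIdeal t) (X n)} := by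
  induction f using MvPolynomial.induction_on with
  | C r =>
    refine .of_forall fun n => ?_
    rw [← algebraMap_eq, AlgHom.commutes]
    exact Subalgebra.algebraMap_mem _ r
  | add p q hp hq =>
    filter_upwards [hp, hq] with n hp hq
    rw [map_add]
    exact add_mem hp hq
  | mul_X p i hp =>
    filter_upwards [hp, Filter.eventually_ge_atTop i] with n hp hn
    obtain ⟨d, rfl⟩ := Nat.exists_eq_add_of_le hn
    rw [map_mul, divisionIdeal_mk_X t i d]
    exact mul_mem hp (Subalgebra.smul_mem _ (Algebra.self_mem_adjoin_singleton R _) _)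

theorem mem_divisionIdeal_of_C_mul_mem [IsDomain R] {t : R} (ht : t ≠ 0)
    {f : MvPolynomial ℕ R} (hf : C t * f ∈ divisionIdeal t) : f ∈ divisionIdeal t := by
  let K := FractionRing R
  let a : K := algebraMap R K t
  have ha : a ≠ 0 := by simpa [a] using ht
  let φ : MvPolynomial ℕ R →ₐ[R] Polynomial K :=
    aeval fun i => Polynomial.C ((a ^ i)⁻¹) * Polynomial.X
  have hC (r : R) : φ (C r) = Polynomial.C (algebraMap R K r) := φ.commutes r
  have hφ : divisionIdeal t ≤ RingHom.ker φ := by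
    refine Ideal.span_le.2 ?_
    rintro _ ⟨i, rfl⟩
    have h : a * (a ^ (i + 1))⁻¹ = (a ^ i)⁻¹ := by
      rw [pow_succ', mul_inv, mul_inv_cancel_left₀ ha]
    simp only [SetLike.mem_coe, RingHom.mem_ker, map_sub, map_mul, hC]
    simp only [φ, aeval_X]
    rw [← mul_assoc, ← Polynomial.C_mul, h, sub_self]
  have hφf : φ f = 0 := by
    have h : φ (C t * f) = 0 := hφ hf
    rw [map_mul, hC] at h
    exact (mul_eq_zero.1 h).resolve_left (Polynomial.C_ne_zero.2 ha)
  obtain ⟨n, hn⟩ := (eventually_mk_mem_adjoin_X t f).exists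
  rw [Algebra.adjoin_singleton_eq_range_aeval] at hn
  obtain ⟨g, hg⟩ := hn
  have hfg : Polynomial.aeval (X n) g - f ∈ divisionIdeal t := by
    refine Ideal.Quotient.eq.1 ?_
    have h := Polynomial.aeval_algHom_apply (Ideal.Quotient.mkₐ R (divisionIdeal t)) (X n) g
    exact h.symm.trans hg
  have hg0 : g = 0 := by
    have h : φ (Polynomial.aeval (X n) g - f) = 0 := hφ hfg
    rw [map_sub, hφf, sub_zero, ← Polynomial.aeval_algHom_apply] at h
    simp only [φ, aeval_X] at h
    rw [← Polynomial.aeval_map_algebraMap K, ← Polynomial.comp_eq_aeval] at h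
    ext m
    have hm := congrArg (fun p => Polynomial.coeff p m) h
    simpa [Polynomial.comp_C_mul_X_coeff, ha] using hm
  simpa [hg0] using hfg

end MvPolynomial

/-!
Claim (a) of Example 6.2: let `k` be a field, `R = k⟦t⟧`, and `S = R[x₁, x₂, …]` the
polynomial ring in countably many variables (here indexed by `ℕ`, with `X i` playing the role
of `x_{i+1}`).  Let `I = (xᵢ − t·x_{i+1} : i ≥ 1)`.  Then `(I : t) = I`, i.e. for every
`f ∈ S`, if `t·f ∈ I` then `f ∈ I`.
-/

theorem ideal_quotient_by_t_eq
    (k : Type) [Field k]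
    (I : Ideal (MvPolynomial ℕ (PowerSeries k)))
    (hI : I = Ideal.span (Set.range fun i : ℕ =>
      (MvPolynomial.X i : MvPolynomial ℕ (PowerSeries k)) -
        MvPolynomial.C (PowerSeries.X : PowerSeries k) * MvPolynomial.X (i + 1))) :
    ∀ f : MvPolynomial ℕ (PowerSeries k),
      MvPolynomial.C (PowerSeries.X : PowerSeries k) * f ∈ I → f ∈ I := by
  subst hI
  exact fun f hf => MvPolynomial.mem_divisionIdeal_of_C_mul_mem PowerSeries.X_ne_zero hf
end

section
/- Let k be a field, R = k⟦t⟧, and S = R[x_1, x_2, …] the polynomial ring over R in countably infinitely many variables. Let H be the ideal of S generated by the elements t^i x_i − t^{i+1} x_{i+1} and x_i − t^2 x_{i+2} for all i ≥ 1, and let I be the ideal generated by the elements x_i − t x_{i+1} for all i ≥ 1; then H ⊆ I. Set A = S/H. Then the R-torsion submodule of A equals I/H; equivalently, for every f ∈ S, there exists a nonzero b ∈ R with b·f ∈ H if and only if f ∈ I. -/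
/-!
Claim (b) of Example 6.2: let `k` be a field, `R = k⟦t⟧`, and `S = R[x₁, x₂, …]` the
polynomial ring in countably many variables (indexed by `ℕ`, with `X i` playing the role of
`x_{i+1}`).  Let `H = (tⁱxᵢ − t^{i+1}x_{i+1}, xᵢ − t²x_{i+2} : i ≥ 1)` and
`I = (xᵢ − t·x_{i+1} : i ≥ 1)`.  Then `H ⊆ I`, and the `R`-torsion submodule of `A = S/H`
equals `I/H`; equivalently, for every `f ∈ S`, there is a nonzero `b ∈ R` with `b·f ∈ H` if
and only if `f ∈ I`.
-/

open MvPolynomial in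
/-- If `X i ≡ t * X (i + 1)` modulo `I` for all `i`, then every polynomial is congruent modulo `I`
to a polynomial in the single variable `X n`, for every large `n`. -/
lemma exists_forall_mk_mem_range_aeval_X {R : Type*} [CommRing R] (t : R)
    (I : Ideal (MvPolynomial ℕ R)) (hI : ∀ i, X i - C t * X (i + 1) ∈ I)
    (f : MvPolynomial ℕ R) :
    ∃ N, ∀ n ≥ N, Ideal.Quotient.mkₐ R I f ∈
      (Polynomial.aeval (R := R) (Ideal.Quotient.mkₐ R I (X n))).range := by
  induction f using MvPolynomial.induction_on with
  | C a =>
    exact ⟨0, fun n _ => Subalgebra.algebraMap_mem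
      (Polynomial.aeval (R := R) (Ideal.Quotient.mkₐ R I (X n))).range a⟩
  | add p q hp hq =>
    obtain ⟨N, hN⟩ := hp
    obtain ⟨M, hM⟩ := hq
    refine ⟨max N M, fun n hn => ?_⟩
    rw [map_add]
    exact add_mem (hN n (le_of_max_le_left hn)) (hM n (le_of_max_le_right hn))
  | mul_X p i hp =>
    obtain ⟨N, hN⟩ := hp
    refine ⟨max N i, fun n hn => ?_⟩
    rw [map_mul]
    refine mul_mem (hN n (le_of_max_le_left hn)) ?_
    have key : ∀ m, Ideal.Quotient.mkₐ R I (X i) =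
        t ^ m • Ideal.Quotient.mkₐ R I (X (i + m)) := by
      intro m
      induction m with
      | zero => simp
      | succ m ih =>
        have h : Ideal.Quotient.mkₐ R I (X (i + m)) =
            t • Ideal.Quotient.mkₐ R I (X (i + m + 1)) := by
          rw [← map_smul, smul_eq_C_mul]
          exact Ideal.Quotient.eq.mpr (hI (i + m))
        rw [ih, h, smul_smul, pow_succ, add_assoc]
    obtain ⟨m, rfl⟩ := Nat.exists_eq_add_of_le (le_of_max_le_right hn)
    rw [key m]
    exact Subalgebra.smul_mem _
      ((AlgHom.mem_range _).mpr ⟨Polynomial.X, Polynomial.aeval_X _⟩) _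

open MvPolynomial in
/-- The quotient of `R[x₀, x₁, …]` by the ideal `(xᵢ - t xᵢ₊₁ : i)` is torsion-free. -/
lemma mem_span_X_sub_C_mul_X_of_C_mul_mem {R : Type*} [CommRing R] [IsDomain R] {t : R}
    (ht : t ≠ 0) {b : R} (hb : b ≠ 0) {f : MvPolynomial ℕ R}
    (h : C b * f ∈ Ideal.span (Set.range fun i : ℕ =>
      (X i : MvPolynomial ℕ R) - C t * X (i + 1))) :
    f ∈ Ideal.span (Set.range fun i : ℕ => (X i : MvPolynomial ℕ R) - C t * X (i + 1)) := by
  set I := Ideal.span (Set.range fun i : ℕ => (X i : MvPolynomial ℕ R) - C t * X (i + 1)) with hI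
  let u : FractionRing R := algebraMap R (FractionRing R) t
  have hu : u ≠ 0 := by simpa [u] using ht
  let φ : MvPolynomial ℕ R →ₐ[R] Polynomial (FractionRing R) :=
    aeval fun i => Polynomial.C (u⁻¹ ^ i) * Polynomial.X
  have hφ : ∀ p ∈ I, φ p = 0 := by
    intro p hp
    have : I ≤ RingHom.ker φ := by
      rw [hI, Ideal.span_le]
      rintro _ ⟨i, rfl⟩
      have hc : u * u⁻¹ ^ (i + 1) = u⁻¹ ^ i := by
        rw [pow_succ', mul_inv_cancel_left₀ hu]
      simp only [SetLike.mem_coe, RingHom.mem_ker, map_sub, map_mul, φ, aeval_X, algHom_C]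
      rw [Polynomial.algebraMap_apply, ← mul_assoc, ← Polynomial.C_mul, hc, sub_self]
    exact this hp
  obtain ⟨n, hn⟩ := exists_forall_mk_mem_range_aeval_X t I
    (fun i => Ideal.subset_span ⟨i, rfl⟩) f
  obtain ⟨g, hg⟩ := hn n le_rfl
  have hfg : f - Polynomial.aeval (X n) g ∈ I := by
    refine Ideal.Quotient.eq.mp ?_
    change Ideal.Quotient.mkₐ R I f = Ideal.Quotient.mkₐ R I _
    rw [← Polynomial.aeval_algHom_apply]
    exact hg.symm
  have hφf : φ f = 0 := by
    have h0 := hφ _ h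
    rw [map_mul, algHom_C, Polynomial.algebraMap_apply] at h0
    exact (mul_eq_zero.mp h0).resolve_left (by simpa using hb)
  have hφg : Polynomial.aeval (Polynomial.C (u⁻¹ ^ n) * Polynomial.X) g = 0 := by
    have h0 := hφ _ hfg
    rw [map_sub, hφf, zero_sub, neg_eq_zero, ← Polynomial.aeval_algHom_apply] at h0
    simpa only [φ, aeval_X] using h0
  have hg0 : g = 0 := by
    ext j
    have h1 : (g.map (algebraMap R (FractionRing R))).comp
        (Polynomial.C (u⁻¹ ^ n) * Polynomial.X) = 0 := by
      rw [Polynomial.comp, Polynomial.eval₂_map]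
      exact hφg
    have h2 := congrArg (Polynomial.coeff · j) h1
    simpa [Polynomial.comp_C_mul_X_coeff, hu] using h2
  simpa [hg0] using hfg

theorem torsion_of_A_eq_I_mod_H
    (k : Type) [Field k]
    (H I : Ideal (MvPolynomial ℕ (PowerSeries k)))
    (hH : H = Ideal.span
      ((Set.range fun i : ℕ =>
        MvPolynomial.C ((PowerSeries.X : PowerSeries k) ^ (i + 1)) * MvPolynomial.X i -
          MvPolynomial.C ((PowerSeries.X : PowerSeries k) ^ (i + 2)) * MvPolynomial.X (i + 1)) ∪
       (Set.range fun i : ℕ =>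
        (MvPolynomial.X i : MvPolynomial ℕ (PowerSeries k)) -
          MvPolynomial.C ((PowerSeries.X : PowerSeries k) ^ 2) * MvPolynomial.X (i + 2))))
    (hI : I = Ideal.span (Set.range fun i : ℕ =>
      (MvPolynomial.X i : MvPolynomial ℕ (PowerSeries k)) -
        MvPolynomial.C (PowerSeries.X : PowerSeries k) * MvPolynomial.X (i + 1))) :
    H ≤ I ∧
    ∀ f : MvPolynomial ℕ (PowerSeries k),
      (∃ b : PowerSeries k, b ≠ 0 ∧ MvPolynomial.C b * f ∈ H) ↔ f ∈ I := by
  have hle : H ≤ I := by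
    have hmem : ∀ i : ℕ, (MvPolynomial.X i : MvPolynomial ℕ (PowerSeries k)) -
        MvPolynomial.C PowerSeries.X * MvPolynomial.X (i + 1) ∈ I := fun i =>
      hI ▸ Ideal.subset_span ⟨i, rfl⟩
    rw [hH, Ideal.span_le]
    rintro _ (⟨i, rfl⟩ | ⟨i, rfl⟩)
    · rw [SetLike.mem_coe]
      convert I.mul_mem_left (MvPolynomial.C (PowerSeries.X ^ (i + 1))) (hmem i) using 1
      simp only [map_pow]
      ring
    · rw [SetLike.mem_coe]
      convert I.add_mem (hmem i)
        (I.mul_mem_left (MvPolynomial.C PowerSeries.X) (hmem (i + 1))) using 1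
      simp only [map_pow]
      ring
  refine ⟨hle, fun f => ⟨?_, fun hf => ?_⟩⟩
  · rintro ⟨b, hb, h⟩
    have h' := hle h
    rw [hI] at h' ⊢
    exact mem_span_X_sub_C_mul_X_of_C_mul_mem PowerSeries.X_ne_zero hb h'
  · rw [hI] at hf
    induction hf using Submodule.span_induction with
    | mem x hx =>
      obtain ⟨i, rfl⟩ := hx
      refine ⟨PowerSeries.X ^ (i + 1), pow_ne_zero _ PowerSeries.X_ne_zero, ?_⟩
      rw [hH]
      refine Ideal.subset_span (Or.inl ⟨i, ?_⟩)
      simp only [map_pow]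
      ring
    | zero => exact ⟨1, one_ne_zero, by simp⟩
    | add x y _ _ hx hy =>
      obtain ⟨b, hb, hbx⟩ := hx
      obtain ⟨c, hc, hcy⟩ := hy
      refine ⟨b * c, mul_ne_zero hb hc, ?_⟩
      convert H.add_mem (H.mul_mem_left (MvPolynomial.C c) hbx)
        (H.mul_mem_left (MvPolynomial.C b) hcy) using 1
      rw [map_mul]
      ring
    | smul a x _ hx =>
      obtain ⟨b, hb, hbx⟩ := hx
      refine ⟨b, hb, ?_⟩
      convert H.mul_mem_left a hbx using 1
      rw [smul_eq_mul]
      ring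
end

section
/- Let k be a field, R = k⟦t⟧, and S = R[x_1, x_2, …] the polynomial ring over R in countably infinitely many variables. Let H be the ideal generated by the elements t^i x_i − t^{i+1} x_{i+1} and x_i − t^2 x_{i+2} for all i ≥ 1, and let I be the ideal generated by the elements x_i − t x_{i+1} for all i ≥ 1. Then x_1 − t·x_2 lies in I but does not lie in the ideal I² + H. -/
open MvPolynomial in
/-- The ring homomorphism `R[x₀, x₁, …] → K[ε]` sending `xᵢ` to `cᵢ ε`. -/
noncomputable def evalInfinitesimal {R K : Type*} [CommRing R] [CommRing K] [Algebra R K]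
    (c : ℕ → K) : MvPolynomial ℕ R →+* TrivSqZeroExt K K :=
  eval₂Hom ((TrivSqZeroExt.inlHom K K).comp (algebraMap R K)) fun i => TrivSqZeroExt.inr (c i)

section

variable {R K : Type*} [CommRing R] [CommRing K] [Algebra R K] (c : ℕ → K)

@[simp]
theorem evalInfinitesimal_C (r : R) :
    evalInfinitesimal c (MvPolynomial.C r) = TrivSqZeroExt.inl (algebraMap R K r) := by
  simp [evalInfinitesimal]

@[simp]
theorem evalInfinitesimal_X (i : ℕ) :
    evalInfinitesimal (R := R) c (MvPolynomial.X i) = TrivSqZeroExt.inr (c i) := by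
  simp [evalInfinitesimal]

theorem fst_evalInfinitesimal (p : MvPolynomial ℕ R) :
    (evalInfinitesimal c p).fst = algebraMap R K (MvPolynomial.constantCoeff p) := by
  have h : (TrivSqZeroExt.fstHom K K K).toRingHom.comp (evalInfinitesimal c) =
      (algebraMap R K).comp MvPolynomial.constantCoeff := by
    apply MvPolynomial.ringHom_ext <;> intros <;> simp
  exact congrArg (fun φ => φ p) h

/-- An ideal generated by polynomials without constant term has square killed by
`evalInfinitesimal`. -/
theorem evalInfinitesimal_eq_zero_of_mem_sq {s : Set (MvPolynomial ℕ R)}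
    (hs : ∀ p ∈ s, MvPolynomial.constantCoeff p = 0) {p : MvPolynomial ℕ R}
    (hp : p ∈ Ideal.span s ^ 2) : evalInfinitesimal c p = 0 := by
  have hle : Ideal.span s ≤ RingHom.ker MvPolynomial.constantCoeff := Ideal.span_le.2 hs
  suffices Ideal.span s ^ 2 ≤ RingHom.ker (evalInfinitesimal c) from this hp
  rw [pow_two, Ideal.mul_le]
  intro a ha b hb
  have ha' : MvPolynomial.constantCoeff a = 0 := hle ha
  have hb' : MvPolynomial.constantCoeff b = 0 := hle hb
  rw [RingHom.mem_ker, map_mul]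
  ext <;> simp [fst_evalInfinitesimal, ha', hb']

/-- If `evalInfinitesimal` maps a set of polynomials without constant term into `R ε`, then it
maps the ideal they generate into `R ε`. -/
theorem snd_evalInfinitesimal_mem_range {s : Set (MvPolynomial ℕ R)}
    (hs : ∀ p ∈ s, MvPolynomial.constantCoeff p = 0)
    (hs' : ∀ p ∈ s, (evalInfinitesimal c p).snd ∈ (algebraMap R K).range)
    {p : MvPolynomial ℕ R} (hp : p ∈ Ideal.span s) :
    (evalInfinitesimal c p).snd ∈ (algebraMap R K).range := by
  have hle : Ideal.span s ≤ RingHom.ker MvPolynomial.constantCoeff := Ideal.span_le.2 hs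
  induction hp using Submodule.span_induction with
  | mem x hx => exact hs' x hx
  | zero => simp
  | add x y _ _ hx hy => simpa using add_mem hx hy
  | smul a x hx ih =>
    have hx' : MvPolynomial.constantCoeff x = 0 := hle hx
    simpa [fst_evalInfinitesimal, hx'] using
      mul_mem (RingHom.mem_range_self (algebraMap R K) (MvPolynomial.constantCoeff a)) ih

end

theorem generator_not_in_I_sq_add_H
    (k : Type) [Field k]
    (H I : Ideal (MvPolynomial ℕ (PowerSeries k)))
    (hH : H = Ideal.span
      ((Set.range fun i : ℕ =>
        MvPolynomial.C ((PowerSeries.X : PowerSeries k) ^ (i + 1)) * MvPolynomial.X i -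
          MvPolynomial.C ((PowerSeries.X : PowerSeries k) ^ (i + 2)) * MvPolynomial.X (i + 1)) ∪
       (Set.range fun i : ℕ =>
        (MvPolynomial.X i : MvPolynomial ℕ (PowerSeries k)) -
          MvPolynomial.C ((PowerSeries.X : PowerSeries k) ^ 2) * MvPolynomial.X (i + 2))))
    (hI : I = Ideal.span (Set.range fun i : ℕ =>
      (MvPolynomial.X i : MvPolynomial ℕ (PowerSeries k)) -
        MvPolynomial.C (PowerSeries.X : PowerSeries k) * MvPolynomial.X (i + 1))) :
    ((MvPolynomial.X 0 : MvPolynomial ℕ (PowerSeries k)) -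
        MvPolynomial.C (PowerSeries.X : PowerSeries k) * MvPolynomial.X 1) ∈ I ∧
    ((MvPolynomial.X 0 : MvPolynomial ℕ (PowerSeries k)) -
        MvPolynomial.C (PowerSeries.X : PowerSeries k) * MvPolynomial.X 1) ∉ (I ^ 2 ⊔ H) := by
  subst hH hI
  refine ⟨Ideal.subset_span ⟨0, rfl⟩, fun hmem => ?_⟩
  let K := FractionRing (PowerSeries k)
  let t : K := algebraMap (PowerSeries k) K PowerSeries.X
  have ht : t ≠ 0 := by simp [t, PowerSeries.X_ne_zero]
  let c : ℕ → K := fun i => if Even i then (t ^ (i + 1))⁻¹ else 0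
  obtain ⟨a, ha, b, hb, hab⟩ := Submodule.mem_sup.1 hmem
  have ha0 := evalInfinitesimal_eq_zero_of_mem_sq c
    (by rintro _ ⟨i, rfl⟩; simp) ha
  have hb0 := snd_evalInfinitesimal_mem_range c (by rintro _ (⟨i, rfl⟩ | ⟨i, rfl⟩) <;> simp)
    (by
      rintro _ (⟨i, rfl⟩ | ⟨i, rfl⟩)
      · by_cases h : Even i
        · refine ⟨1, ?_⟩
          have h' : ¬ Even (i + 1) := by simpa [Nat.even_add_one] using h
          have hi : t ^ (i + 1) * (t ^ (i + 1))⁻¹ = 1 := mul_inv_cancel₀ (pow_ne_zero _ ht)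
          simpa [c, h, h'] using hi.symm
        · refine ⟨-1, ?_⟩
          have h' : Even (i + 1) := by simpa [Nat.even_add_one] using h
          have hi : t ^ (i + 2) * (t ^ (i + 1 + 1))⁻¹ = 1 := mul_inv_cancel₀ (pow_ne_zero _ ht)
          simpa [c, h, h'] using congrArg Neg.neg hi.symm
      · refine ⟨0, ?_⟩
        by_cases h : Even i
        · have h' : Even (i + 2) := by simpa [Nat.even_add] using h
          have hi : (t ^ (i + 1))⁻¹ = t ^ 2 * (t ^ (i + 2 + 1))⁻¹ := by
            rw [show i + 2 + 1 = 2 + (i + 1) by ring, pow_add t 2, mul_inv,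
              mul_inv_cancel_left₀ (pow_ne_zero 2 ht)]
          simpa [c, h, h'] using (sub_eq_zero.2 hi).symm
        · have h' : ¬ Even (i + 2) := by simpa [Nat.even_add] using h
          simp [c, h, h']) hb
  have hval := congrArg (fun p => (evalInfinitesimal c p).snd) hab
  obtain ⟨r, hr⟩ := hb0
  have hrt : algebraMap (PowerSeries k) K r = t⁻¹ := by
    simpa [ha0, ← hr, c] using hval
  have hunit : r * PowerSeries.X = 1 := by
    apply IsFractionRing.injective (PowerSeries k) K
    rw [map_mul, hrt, map_one]
    exact inv_mul_cancel₀ ht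
  simpa using congrArg PowerSeries.constantCoeff hunit
end

section
/- There exist a noetherian local ring R and an injective R-linear map g : M → N of R-modules such that N is a flat R-module, the base-changed map g ⊗_R k(p) : M ⊗_R k(p) → N ⊗_R k(p) is injective for every prime ideal p of R, and yet g is NOT a pure map of R-modules. -/
/-!
Corollary 6.4: there exist a noetherian local ring `R` and an injective `R`-linear map
`g : M → N` such that `N` is flat over `R`, the base change `g ⊗_R k(p)` is injective for
every prime `p` of `R` (where `k(p) = Frac(R ⧸ p)`), and yet `g` is NOT pure.
-/

set_option synthInstance.maxHeartbeats 1000000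

/-- The data of a counterexample as in Corollary 6.4 of the paper. -/
structure NonPureCounterexample where
  R : Type
  M : Type
  N : Type
  [instCommRing : CommRing R]
  [instNoetherian : IsNoetherianRing R]
  [instLocal : IsLocalRing R]
  [instAddCommGroupM : AddCommGroup M]
  [instAddCommGroupN : AddCommGroup N]
  [instModuleM : Module R M]
  [instModuleN : Module R N]
  g : M →ₗ[R] N
  injective : Function.Injective g
  flat_N : Module.Flat R N
  fiber_injective : ∀ (p : Ideal R) [p.IsPrime],
    Function.Injective (LinearMap.rTensor (FractionRing (R ⧸ p)) g)
  not_pure : ¬ ∀ (E : Type) [AddCommGroup E] [Module R E],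
    Function.Injective (LinearMap.rTensor E g)

namespace NonPureCounterexample

open TensorProduct

section

variable {R : Type*} [CommRing R]

/-- The elements of an algebra `N` that some power of `x` multiplies into the image of `R`. -/
def awaySubmodule (N : Type*) [CommRing N] [Algebra R N] (x : R) : Submodule R N where
  carrier := {n | ∃ k : ℕ, x ^ k • n ∈ LinearMap.range (Algebra.linearMap R N)}
  zero_mem' := ⟨0, by simp only [smul_zero, zero_mem]⟩
  add_mem' := by
    rintro a b ⟨k, hk⟩ ⟨l, hl⟩
    refine ⟨k + l, ?_⟩
    rw [smul_add]
    refine add_mem ?_ ?_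
    · rw [add_comm, pow_add, mul_smul]
      exact Submodule.smul_mem _ _ hk
    · rw [pow_add, mul_smul]
      exact Submodule.smul_mem _ _ hl
  smul_mem' := by
    rintro c a ⟨k, hk⟩
    refine ⟨k, ?_⟩
    rw [smul_comm]
    exact Submodule.smul_mem _ _ hk

section

variable {N : Type*} [CommRing N] [Algebra R N] {x y : R}

lemma mem_awaySubmodule {n : N} :
    n ∈ awaySubmodule N x ↔ ∃ (k : ℕ) (a : R), algebraMap R N a = x ^ k • n :=
  Iff.rfl

lemma exists_smul_eq_of_isUnit (hx : IsUnit (algebraMap R N x)) (n : N) : ∃ n' : N, x • n' = n := by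
  obtain ⟨u, hu⟩ := hx
  exact ⟨↑u⁻¹ * n, by rw [Algebra.smul_def, ← hu, Units.mul_inv_cancel_left]⟩

lemma exists_mem_awaySubmodule_smul_eq (hx : IsUnit (algebraMap R N x)) {n : N}
    (hn : n ∈ awaySubmodule N x) : ∃ n' ∈ awaySubmodule N x, x • n' = n := by
  obtain ⟨n', rfl⟩ := exists_smul_eq_of_isUnit hx n
  obtain ⟨k, hk⟩ := hn
  exact ⟨n', ⟨k + 1, by rwa [pow_succ, mul_smul]⟩, rfl⟩

lemma exists_pow_smul_mem_awaySubmodule [IsLocalization.Away (x * y) N] (n : N) :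
    ∃ k : ℕ, x ^ k • n ∈ awaySubmodule N y := by
  obtain ⟨⟨a, ⟨_, k, rfl⟩⟩, h⟩ := IsLocalization.surj (Submonoid.powers (x * y)) n
  refine ⟨k, mem_awaySubmodule.2 ⟨k, a, ?_⟩⟩
  rw [← h, smul_smul, ← mul_pow, mul_comm y x, Algebra.smul_def, mul_comm]

lemma isLocalizedModule_powers_subtype (hx : IsUnit (algebraMap R N x)) (M : Submodule R N)
    (h : ∀ n : N, ∃ k : ℕ, x ^ k • n ∈ M) :
    IsLocalizedModule (Submonoid.powers x) M.subtype where
  map_units := by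
    rintro ⟨_, k, rfl⟩
    simp only [map_pow]
    refine IsUnit.pow k ?_
    have := hx.map (Algebra.lmul R N)
    convert this using 1
    ext n
    simp [Algebra.smul_def]
  surj n := by
    obtain ⟨k, hk⟩ := h n
    exact ⟨(⟨_, hk⟩, ⟨x ^ k, k, rfl⟩), rfl⟩
  exists_of_eq h := ⟨1, congrArg _ (Subtype.ext h)⟩

end

section

variable {M N : Type*} [AddCommGroup M] [Module R M] [AddCommGroup N] [Module R N]

lemma rTensor_injective_of_isUnit {x : R} (Q : Type*) [CommRing Q] [Algebra R Q]
    (hx : IsUnit (algebraMap R Q x)) (g : M →ₗ[R] N)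
    [IsLocalizedModule (Submonoid.powers x) g] : Function.Injective (g.rTensor Q) := by
  have hloc : IsLocalizedModule (Submonoid.powers x) (g.rTensor Q) :=
    IsLocalizedModule.rTensor (R := R) (A := R) (N := Q) (Submonoid.powers x) g
  have hreg (k : ℕ) : Function.Injective fun t : M ⊗[R] Q ↦ x ^ k • t := by
    obtain ⟨u, hu⟩ := hx.pow k
    refine Function.LeftInverse.injective
      (g := LinearMap.lTensor M (LinearMap.mulLeft R (↑u⁻¹ : Q))) fun t ↦ ?_
    have he : x ^ k • LinearMap.mulLeft R (↑u⁻¹ : Q) = LinearMap.id := by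
      ext q
      rw [LinearMap.smul_apply, LinearMap.mulLeft_apply, Algebra.smul_def, map_pow, ← hu,
        Units.mul_inv_cancel_left, LinearMap.id_apply]
    rw [map_smul, ← LinearMap.smul_apply, ← LinearMap.lTensor_smul, he, LinearMap.lTensor_id_apply]
  intro s t hst
  obtain ⟨⟨_, k, rfl⟩, h⟩ := IsLocalizedModule.exists_of_eq (S := Submonoid.powers x) hst
  exact hreg k h

lemma subsingleton_tensorProduct_of_smul_eq_zero {x y : R} (Q : Type*) [AddCommGroup Q] [Module R Q]
    (hx : ∀ q : Q, x • q = 0) (hy : ∀ q : Q, y • q = 0)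
    (hM : ∀ m : M, ∃ a b : M, x • a + y • b = m) : Subsingleton (M ⊗[R] Q) := by
  refine subsingleton_of_forall_eq 0 fun t ↦ ?_
  induction t with
  | zero => rfl
  | add s t hs ht => rw [hs, ht, add_zero]
  | tmul m q =>
    obtain ⟨a, b, rfl⟩ := hM m
    simp only [add_tmul, smul_tmul, hx, hy, tmul_zero, add_zero]

lemma exists_smul_eq_of_rTensor_injective {x : R} (g : M →ₗ[R] N)
    (hN : ∀ n : N, ∃ n', x • n' = n)
    (h : Function.Injective (g.rTensor (R ⧸ Ideal.span {x}))) (m : M) : ∃ m', x • m' = m := by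
  have hzero : m ⊗ₜ[R] (1 : R ⧸ Ideal.span {x}) = 0 := by
    apply h
    obtain ⟨n, hn⟩ := hN (g m)
    have hx1 : x • (1 : R ⧸ Ideal.span {x}) = 0 := by
      rw [Algebra.smul_def, mul_one, Ideal.Quotient.algebraMap_eq, Ideal.Quotient.eq_zero_iff_mem]
      exact Ideal.mem_span_singleton_self x
    rw [map_zero, LinearMap.rTensor_tmul, ← hn, smul_tmul, hx1, tmul_zero]
  have := congrArg (TensorProduct.tensorQuotEquivQuotSMul M (Ideal.span {x})) hzero
  rw [map_zero, ← map_one (Ideal.Quotient.mk _),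
    TensorProduct.tensorQuotEquivQuotSMul_tmul_mk, one_smul,
    Submodule.Quotient.mk_eq_zero, Submodule.ideal_span_singleton_smul] at this
  obtain ⟨m', -, hm'⟩ := this
  exact ⟨m', hm'⟩

end

section

variable {N : Type*} [CommRing N] [Algebra R N] {x y : R}

/-- The submodule `R_x + R_y` of `R_{xy}`, whose quotient is a local cohomology module. -/
abbrev cechSubmodule (N : Type*) [CommRing N] [Algebra R N] (x y : R) : Submodule R N :=
  awaySubmodule N x ⊔ awaySubmodule N y

lemma exists_smul_add_smul_eq (hx : IsUnit (algebraMap R N x)) (hy : IsUnit (algebraMap R N y))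
    (m : cechSubmodule N x y) : ∃ a b : cechSubmodule N x y, x • a + y • b = m := by
  obtain ⟨s, hs, t, ht, hst⟩ := Submodule.mem_sup.1 m.2
  obtain ⟨a, ha, rfl⟩ := exists_mem_awaySubmodule_smul_eq hx hs
  obtain ⟨b, hb, rfl⟩ := exists_mem_awaySubmodule_smul_eq hy ht
  exact ⟨⟨a, Submodule.mem_sup_left ha⟩, ⟨b, Submodule.mem_sup_right hb⟩, Subtype.ext hst⟩

lemma rTensor_fractionRing_injective [IsLocalization.Away (x * y) N]
    (hx : IsUnit (algebraMap R N x)) (hy : IsUnit (algebraMap R N y)) (p : Ideal R) [p.IsPrime] :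
    Function.Injective
      ((cechSubmodule N x y).subtype.rTensor (FractionRing (R ⧸ p))) := by
  have hunit {r : R} (hr : r ∉ p) : IsUnit (algebraMap R (FractionRing (R ⧸ p)) r) := by
    rw [IsScalarTower.algebraMap_apply R (R ⧸ p), isUnit_iff_ne_zero, ne_eq,
      FaithfulSMul.algebraMap_eq_zero_iff, Ideal.Quotient.algebraMap_eq,
      Ideal.Quotient.eq_zero_iff_mem]
    exact hr
  have hzero {r : R} (hr : r ∈ p) (q : FractionRing (R ⧸ p)) : r • q = 0 := by
    rw [Algebra.smul_def, IsScalarTower.algebraMap_apply R (R ⧸ p), Ideal.Quotient.algebraMap_eq,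
      Ideal.Quotient.eq_zero_iff_mem.2 hr, map_zero, zero_mul]
  by_cases hxp : x ∈ p
  · by_cases hyp : y ∈ p
    · have := subsingleton_tensorProduct_of_smul_eq_zero (FractionRing (R ⧸ p))
        (hzero hxp) (hzero hyp) (exists_smul_add_smul_eq (N := N) hx hy)
      exact Function.injective_of_subsingleton _
    · have : IsLocalization.Away (y * x) N := by rwa [mul_comm]
      have := isLocalizedModule_powers_subtype hy (cechSubmodule N x y) fun n ↦
        (exists_pow_smul_mem_awaySubmodule (x := y) (y := x) n).imp fun _ ↦ Submodule.mem_sup_left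
      exact rTensor_injective_of_isUnit _ (hunit hyp) _
  · have := isLocalizedModule_powers_subtype hx (cechSubmodule N x y) fun n ↦
      (exists_pow_smul_mem_awaySubmodule (x := x) (y := y) n).imp fun _ ↦ Submodule.mem_sup_right
    exact rTensor_injective_of_isUnit _ (hunit hxp) _

lemma cechSubmodule_eq_top_of_rTensor_injective [IsLocalization.Away (x * y) N]
    (hx : IsUnit (algebraMap R N x))
    (h : Function.Injective
      ((cechSubmodule N x y).subtype.rTensor (R ⧸ Ideal.span {x}))) :
    cechSubmodule N x y = ⊤ := by
  have hdiv := exists_smul_eq_of_rTensor_injective _ (exists_smul_eq_of_isUnit hx) h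
  have hcancel {n : N} (hn : x • n ∈ cechSubmodule N x y) : n ∈ cechSubmodule N x y := by
    obtain ⟨m, hm⟩ := hdiv ⟨_, hn⟩
    have hmn : x • (m : N) = x • n := congrArg Subtype.val hm
    rw [Algebra.smul_def, Algebra.smul_def] at hmn
    rw [← hx.mul_left_cancel hmn]
    exact m.2
  refine eq_top_iff.2 fun n _ ↦ ?_
  have hcancel_pow (k : ℕ) : x ^ k • n ∈ cechSubmodule N x y → n ∈ cechSubmodule N x y := by
    induction k with
    | zero => simp only [pow_zero, one_smul, imp_self]
    | succ k ih =>
      rw [pow_succ', mul_smul]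
      exact fun hn ↦ ih (hcancel hn)
  obtain ⟨k, hk⟩ := exists_pow_smul_mem_awaySubmodule (x := x) (y := y) n
  exact hcancel_pow k (Submodule.mem_sup_right hk)

lemma exists_pow_mul_pow_eq_of_cechSubmodule_eq_top (hinj : Function.Injective (algebraMap R N))
    (hx : IsUnit (algebraMap R N x)) (hy : IsUnit (algebraMap R N y))
    (h : cechSubmodule N x y = ⊤) :
    ∃ (k : ℕ) (a b : R), x ^ k * y ^ k = a * x ^ (k + 1) + b * y ^ (k + 1) := by
  obtain ⟨n, hn⟩ := exists_smul_eq_of_isUnit (hx.mul hy |> (map_mul (algebraMap R N) x y ▸ ·)) 1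
  obtain ⟨s, hs, t, ht, rfl⟩ := Submodule.mem_sup.1 (h ▸ Submodule.mem_top : n ∈ cechSubmodule N x y)
  obtain ⟨k, a, ha⟩ := mem_awaySubmodule.1 hs
  obtain ⟨l, b, hb⟩ := mem_awaySubmodule.1 ht
  refine ⟨k + l, y ^ (k + 1) * b, x ^ (l + 1) * a, hinj ?_⟩
  simp only [Algebra.smul_def, map_add, map_mul, map_pow] at *
  rw [ha, hb]
  linear_combination -(algebraMap R N x ^ (k + l) * algebraMap R N y ^ (k + l)) * hn

end

end

open PowerSeries in
lemma X_pow_mul_C_pow_ne {A : Type*} [CommRing A] [IsDomain A] {y : A} (hy0 : y ≠ 0)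
    (hy : ¬ IsUnit y) (k : ℕ) (a b : A⟦X⟧) :
    X ^ k * C y ^ k ≠ a * X ^ (k + 1) + b * C y ^ (k + 1) := by
  intro h
  have hc := congrArg (coeff k) h
  rw [← map_pow, ← map_pow, coeff_mul_C, coeff_X_pow_self, map_add, coeff_mul_C,
    coeff_mul_X_pow', if_neg (by lia), zero_add, one_mul, pow_succ', ← mul_assoc] at hc
  exact hy (IsUnit.of_mul_eq_one_right _ (mul_right_cancel₀ (pow_ne_zero k hy0)
    (hc.symm.trans (one_mul _).symm)))

end NonPureCounterexample

theorem exists_non_pure_counterexample : Nonempty NonPureCounterexample := by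
  let x : PowerSeries (PowerSeries ℚ) := PowerSeries.X
  let y : PowerSeries (PowerSeries ℚ) := PowerSeries.C PowerSeries.X
  have hx0 : x ≠ 0 := PowerSeries.X_ne_zero
  have hy0 : y ≠ 0 := (map_ne_zero_iff _ PowerSeries.C_injective).2 PowerSeries.X_ne_zero
  let N := Localization.Away (x * y)
  have hxy : IsUnit (algebraMap (PowerSeries (PowerSeries ℚ)) N x *
      algebraMap (PowerSeries (PowerSeries ℚ)) N y) := by
    rw [← map_mul]
    exact IsLocalization.Away.algebraMap_isUnit (x * y)
  have hx := isUnit_of_mul_isUnit_left hxy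
  have hy := isUnit_of_mul_isUnit_right hxy
  have hinj : Function.Injective (algebraMap (PowerSeries (PowerSeries ℚ)) N) :=
    IsLocalization.injective N (powers_le_nonZeroDivisors_of_noZeroDivisors (mul_ne_zero hx0 hy0))
  exact ⟨{
    R := PowerSeries (PowerSeries ℚ)
    M := NonPureCounterexample.cechSubmodule N x y
    N := N
    g := (NonPureCounterexample.cechSubmodule N x y).subtype
    injective := Subtype.val_injective
    flat_N := IsLocalization.flat N (Submonoid.powers (x * y))
    fiber_injective := fun p _ ↦ NonPureCounterexample.rTensor_fractionRing_injective hx hy p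
    not_pure := fun hpure ↦ by
      obtain ⟨k, a, b, h⟩ :=
        NonPureCounterexample.exists_pow_mul_pow_eq_of_cechSubmodule_eq_top hinj hx hy
          (NonPureCounterexample.cechSubmodule_eq_top_of_rTensor_injective hx (hpure _))
      exact NonPureCounterexample.X_pow_mul_C_pow_ne PowerSeries.X_ne_zero
        PowerSeries.X_prime.not_isUnit k a b h }⟩
end
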